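/- Let I ⊂ ℝ be a finite interval. There is a constant C depending only on I such that for every complex number s = σ + it with σ ∈ I and t ≥ 2π, and for all real α, β ≥ 1 with t = 2παβ, one has |ζ(s) − Σ_{n ≤ α} n^{−s} − χ(s)·Σ_{n ≤ β} n^{−(1−s)}| ≤ C·(α^{−σ} + t^{1/2−σ}·β^{σ−1}), where the sums run over positive integers n satisfying the stated inequality. -/

import Mathlib

open Complex Real MeasureTheory

noncomputable section

def chi (s : ℂ) : ℂ := (π : ℂ) ^ (s - 1/2) * Complex.Gamma ((1 - s)/2) / Complex.Gamma (s/2)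

def RSOmega : Set ℂ := {s : ℂ | s.im ≠ 0 ∨ (0 < s.re ∧ s.re < 1)}

def IsRSTheta (ϑ : ℂ → ℂ) : Prop :=
  DifferentiableOn ℂ ϑ RSOmega ∧ (∀ s ∈ RSOmega, Complex.exp (-2 * I * ϑ s) = chi s) ∧
    ϑ (1/2) = 0

def zetaSum (x : ℝ) (s : ℂ) : ℂ := ∑ n ∈ Finset.Icc 1 ⌊x⌋₊, (n : ℂ) ^ (-s)

def Upsilon (u τ : ℂ) : ℂ :=
  ∫ v : ℝ, Complex.exp (3 * (π:ℂ) * I / 4) *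
    (Complex.exp (-(π:ℂ) * I * τ * (1/2 + Complex.exp (3 * (π:ℂ) * I / 4) * v) ^ 2
        + 2 * (π:ℂ) * I * u * (1/2 + Complex.exp (3 * (π:ℂ) * I / 4) * v)) /
      (Complex.exp (2 * (π:ℂ) * I * (1/2 + Complex.exp (3 * (π:ℂ) * I / 4) * v)) - 1))

def G (u τ : ℂ) : ℂ :=
  τ ^ ((1:ℂ)/4) * Complex.exp (-(π:ℂ) * I * u ^ 2 / 2 + (π:ℂ) * I / 8) *
    Upsilon (τ ^ ((1:ℂ)/2) * u) τ

def Gderiv (k : ℕ) (u τ : ℂ) : ℂ := iteratedDeriv k (fun w => G w τ) u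

def hermiteH (n : ℕ) (x : ℂ) : ℂ :=
  (Nat.factorial n : ℂ) * ∑ j ∈ Finset.range (n / 2 + 1),
    (-1:ℂ) ^ j / ((Nat.factorial j : ℂ) * (Nat.factorial (n - 2*j) : ℂ)) * (2 * x) ^ (n - 2*j)

def obell (p : ℕ → ℂ) (i j : ℕ) : ℂ :=
  ∑ f ∈ (Finset.Nat.antidiagonalTuple j i).filter (fun f => ∀ l, 1 ≤ f l), ∏ l, p (f l)

def bernoulliPoly (n : ℕ) (x : ℂ) : ℂ := Polynomial.aeval x (Polynomial.bernoulli n)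

def fseq (σ : ℝ) (n : ℕ) : ℂ :=
  (bernoulliPoly (n+1) ((σ:ℂ)/2) + (-1:ℂ)^(n+1) * bernoulliPoly (n+1) ((1-(σ:ℂ))/2)) /
    (2*(n:ℂ)*((n:ℂ)+1))

def um (m : ℕ) (σ : ℝ) : ℂ :=
  (-2:ℂ)^m * ∑ k ∈ Finset.range (m+1), obell (fseq σ) m k / (Nat.factorial k : ℂ)

def seqA (j : ℕ) : ℂ := (-1:ℂ)^(j+1) / ((j:ℂ) + 2)

def seqB (j : ℕ) : ℂ := (-1:ℂ)^(j+1) / (j:ℂ)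

def dd (m r : ℕ) (σ : ℝ) : ℂ :=
  ∑ n ∈ Finset.Icc r m, (obell seqA n r / (Nat.factorial r : ℂ)) *
    ∑ k ∈ Finset.range (m - n + 1),
      (obell seqB (m - n) k / (Nat.factorial k : ℂ)) * ((σ:ℂ) - 1)^k

def qq (n ℓ : ℕ) (σ : ℝ) : ℂ :=
  ∑ m ∈ Finset.Icc (ℓ - n) (ℓ / 3), um m σ * dd (n - 2*m) (n + m - ℓ) σ

def PP (n k : ℕ) (x : ℂ) (σ : ℝ) : ℂ :=
  Complex.exp (3 * (π:ℂ) * I * (k:ℂ) / 4) * ∑ ℓ ∈ Finset.range (k/2 + 1),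
    (Nat.choose (3*n - 2*ℓ) (3*n - k) : ℂ) * (-1:ℂ)^(n + ℓ) * 2^(2*ℓ) / 2^k *
      qq n ℓ σ * hermiteH (k - 2*ℓ) (Complex.exp (-(π:ℂ) * I / 4) * x)

def IsAk (s : ℂ) (a : ℕ → ℂ) : Prop :=
  a 0 = 1 ∧ ∀ k : ℕ, ((k:ℂ) + 1) * (Real.sqrt s.im : ℂ) * a (k+1) =
    -((k:ℂ) + 1 - (s.re:ℂ)) * a k + I * (if 2 ≤ k then a (k-2) else 0)

def IsPsi (Ψ : ℂ → ℂ) : Prop :=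
  Differentiable ℂ Ψ ∧ ∀ u : ℂ, Complex.cos ((π:ℂ)*u) ≠ 0 →
    Ψ u = Complex.cos ((π:ℂ)*(u^2/2 - u - 1/8)) / Complex.cos ((π:ℂ)*u)

def wfun (s z : ℂ) : ℂ :=
  Complex.exp ((s - 1) * Complex.log (1 + z / (Real.sqrt s.im : ℂ))
    - I * (Real.sqrt s.im : ℂ) * z + I * z^2 / 2)

def rn (n : ℕ) (s z : ℂ) : ℂ :=
  wfun s z - ∑ k ∈ Finset.range n, (iteratedDeriv k (wfun s) 0 / (Nat.factorial k : ℂ)) * z^k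

def GammaOmega : Set ℂ := {s : ℂ | s.im ≠ 0 ∨ 0 < s.re}

def IsLogGamma (L : ℂ → ℂ) : Prop :=
  DifferentiableOn ℂ L GammaOmega ∧ (∀ s ∈ GammaOmega, Complex.exp (L s) = Complex.Gamma s) ∧
    L 1 = 0

def gseq (σ : ℝ) (n : ℕ) : ℂ := -(bernoulliPoly (n+1) (σ:ℂ)) / ((n:ℂ)*((n:ℂ)+1))

def gammam (m : ℕ) (σ : ℝ) : ℂ :=
  I^m * ∑ k ∈ Finset.range (m+1), obell (gseq σ) m k / (Nat.factorial k : ℂ)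

def afeP (s w : ℂ) : ℂ := ∑' j : ℕ, w ^ j / ((Nat.factorial j : ℂ) * ((j:ℂ) + 1 - s))

def afePhi (s c z : ℂ) : ℂ := z ^ (1 - s) * afeP s (c * z)

lemma afe_hasSum_congr {f g : ℕ → ℂ} {a : ℂ} (h : ∀ j, f j = g j) (hg : HasSum g a) : HasSum f a := by
  rw [funext h]; exact hg

lemma afe_den_norm (s : ℂ) (j : ℕ) : |s.im| ≤ ‖(j:ℂ) + 1 - s‖ := by
  have := Complex.abs_im_le_norm ((j:ℂ) + 1 - s)
  simpa using this

lemma afe_den_ne {s : ℂ} (hs : s.im ≠ 0) (j : ℕ) : (j:ℂ) + 1 - s ≠ 0 := by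
  intro h
  have := afe_den_norm s j
  rw [h, norm_zero] at this
  exact hs (abs_nonpos_iff.mp this)

lemma afe_term_le {s : ℂ} (hs : s.im ≠ 0) (w : ℂ) (R : ℝ) (hw : ‖w‖ ≤ R) (j : ℕ) :
    ‖w ^ j / ((Nat.factorial j : ℂ) * ((j:ℂ) + 1 - s))‖ ≤ (R ^ j / Nat.factorial j) * |s.im|⁻¹ := by
  have hR : 0 ≤ R := (norm_nonneg _).trans hw
  have h1 := afe_den_norm s j
  have h0 : 0 < |s.im| := abs_pos.mpr hs
  rw [norm_div, norm_mul, norm_pow, Complex.norm_natCast, div_mul_eq_div_div, div_eq_mul_inv (_ / _)]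
  gcongr

lemma afe_summable_bound (s : ℂ) (R : ℝ) :
    Summable (fun j : ℕ => (R ^ j / Nat.factorial j) * |s.im|⁻¹) :=
  (Real.summable_pow_div_factorial R).mul_right _

lemma afeP_summable {s : ℂ} (hs : s.im ≠ 0) (w : ℂ) :
    Summable (fun j : ℕ => w ^ j / ((Nat.factorial j : ℂ) * ((j:ℂ) + 1 - s))) :=
  Summable.of_norm_bounded (afe_summable_bound s ‖w‖) (afe_term_le hs w _ le_rfl)

lemma afeP_norm_le {s : ℂ} (hs : s.im ≠ 0) (w : ℂ) :
    ‖afeP s w‖ ≤ Real.exp ‖w‖ / |s.im| := by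
  have h : HasSum (fun j : ℕ => (‖w‖ ^ j / Nat.factorial j) * |s.im|⁻¹) (Real.exp ‖w‖ * |s.im|⁻¹) := by
    have := NormedSpace.expSeries_div_hasSum_exp (𝔸 := ℝ) ‖w‖
    rw [← Real.exp_eq_exp_ℝ] at this
    exact this.mul_right _
  rw [div_eq_mul_inv]
  exact tsum_of_norm_bounded h (afe_term_le hs w _ le_rfl)

lemma afeP_rec {s : ℂ} (hs : s.im ≠ 0) (w : ℂ) :
    s * afeP (s + 1) w = - Complex.exp w + w * afeP s w := by
  have hs1 : (s + 1).im ≠ 0 := by simpa using hs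
  have h1 := (afeP_summable hs w).hasSum.mul_left w
  have h2 : HasSum (fun j : ℕ => (j:ℂ) * w ^ j / ((Nat.factorial j : ℂ) * ((j:ℂ) - s))) (w * afeP s w) := by
    rw [← hasSum_nat_add_iff' 1]
    simp only [Finset.range_one, Finset.sum_singleton, Nat.cast_zero, zero_mul, zero_div, sub_zero]
    refine afe_hasSum_congr (fun j => ?_) (h1)
    have := afe_den_ne hs j
    have h3 : (Nat.factorial j : ℂ) ≠ 0 := by exact_mod_cast Nat.factorial_ne_zero j
    have h4 : (j:ℂ) + 1 ≠ 0 := by exact_mod_cast Nat.succ_ne_zero j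
    rw [Nat.factorial_succ]
    push_cast
    field_simp
    ring
  have h3 : HasSum (fun j : ℕ => w ^ j / (Nat.factorial j : ℂ)) (Complex.exp w) := by
    have := NormedSpace.expSeries_div_hasSum_exp (𝔸 := ℂ) w
    rwa [← Complex.exp_eq_exp_ℂ] at this
  have h4 := (afeP_summable hs1 w).hasSum.mul_left s
  have h5 := h3.neg.add h2
  refine h4.unique ?_
  refine afe_hasSum_congr (fun j => ?_) (h5)
  have h6 := afe_den_ne hs1 j
  have h7 : (j:ℂ) - s ≠ 0 := by convert h6 using 1; ring
  have h8 : (Nat.factorial j : ℂ) ≠ 0 := by exact_mod_cast Nat.factorial_ne_zero j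
  have h9 : (j:ℂ) + 1 - (s + 1) = j - s := by ring
  rw [h9]
  field_simp
  ring

lemma afeP_hasDerivAt {s : ℂ} (hs : s.im ≠ 0) (w : ℂ) :
    HasDerivAt (afeP s) (afeP (s - 1) w) w := by
  have hs1 : (s - 1).im ≠ 0 := by simpa using hs
  set F : ℕ → ℂ → ℂ := fun j w => w ^ j / ((Nat.factorial j : ℂ) * ((j:ℂ) + 1 - s)) with hF
  have hd : ∀ i, DifferentiableOn ℂ (F i) (Metric.ball 0 (‖w‖ + 1)) := by
    intro i
    simp only [hF]
    fun_prop
  have hle : ∀ i, ∀ z ∈ Metric.ball (0:ℂ) (‖w‖ + 1), ‖F i z‖ ≤ ((‖w‖+1) ^ i / Nat.factorial i) * |s.im|⁻¹ := by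
    intro i z hz
    refine afe_term_le hs z _ ?_ i
    simpa using (mem_ball_zero_iff.mp hz).le
  have hw : w ∈ Metric.ball (0:ℂ) (‖w‖ + 1) := by simp
  have h1 := Complex.hasSum_deriv_of_summable_norm (afe_summable_bound s (‖w‖+1)) hd Metric.isOpen_ball hle hw
  have h2 := Complex.differentiableOn_tsum_of_summable_norm (afe_summable_bound s (‖w‖+1)) hd Metric.isOpen_ball hle
  have h3 := (h2.differentiableAt (Metric.isOpen_ball.mem_nhds hw)).hasDerivAt
  have h4 : deriv (fun w => ∑' i, F i w) w = afeP (s - 1) w := by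
    refine h1.unique ?_
    rw [← hasSum_nat_add_iff' 1]
    simp only [Finset.range_one, Finset.sum_singleton]
    have h0 : deriv (F 0) w = 0 := by simp [hF]
    rw [h0, sub_zero]
    refine afe_hasSum_congr (fun j => ?_) ((afeP_summable hs1 w).hasSum)
    have h8 : (Nat.factorial j : ℂ) ≠ 0 := by exact_mod_cast Nat.factorial_ne_zero j
    have h4 : (j:ℂ) + 1 ≠ 0 := by exact_mod_cast Nat.succ_ne_zero j
    have h6 := afe_den_ne hs (j+1)
    have h7 := afe_den_ne hs1 j
    have h9 : ((j + 1 : ℕ) : ℂ) + 1 - s = j + 1 - (s - 1) := by push_cast; ring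
    simp only [hF, h9]
    rw [deriv_div_const, deriv_pow_field, Nat.factorial_succ]
    push_cast
    field_simp
    try simp
  rw [h4] at h3
  exact h3

lemma afePhi_hasDerivAt {s : ℂ} (hs : s.im ≠ 0) (c : ℂ) {z : ℂ} (hz : z ∈ Complex.slitPlane) :
    HasDerivAt (afePhi s c) (z ^ (-s) * Complex.exp (c * z)) z := by
  have hs1 : (s - 1).im ≠ 0 := by simpa using hs
  have hz0 : z ≠ 0 := Complex.slitPlane_ne_zero hz
  have h1 : HasDerivAt (fun z : ℂ => z ^ (1 - s)) ((1 - s) * z ^ (1 - s - 1)) z := by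
    simpa using (hasDerivAt_id z).cpow_const (c := 1 - s) hz
  have h2 : HasDerivAt (fun z : ℂ => afeP s (c * z)) (afeP (s - 1) (c * z) * (c * 1)) z :=
    (afeP_hasDerivAt hs (c * z)).comp z ((hasDerivAt_id z).const_mul c)
  have h3 := h1.mul h2
  refine h3.congr_deriv ?_
  have h4 := afeP_rec hs1 (c * z)
  rw [sub_add_cancel] at h4
  have h5 : z ^ (1 - s) = z * z ^ (-s) := by
    rw [sub_eq_add_neg, Complex.cpow_add _ _ hz0, Complex.cpow_one]
  have h6 : (1 - s - 1) = -s := by ring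
  rw [h5, h6]
  linear_combination (- z ^ (-s)) * h4

lemma afePhi_rec {s : ℂ} (hs : s.im ≠ 0) (c : ℂ) {z : ℂ} (hz : z ≠ 0) :
    s * afePhi (s + 1) c z = - (z ^ (-s) * Complex.exp (c * z)) + c * afePhi s c z := by
  have h4 := afeP_rec hs (c * z)
  have h5 : z ^ (1 - s) = z * z ^ (-s) := by
    rw [sub_eq_add_neg, Complex.cpow_add _ _ hz, Complex.cpow_one]
  have h6 : (1 - (s + 1)) = -s := by ring
  unfold afePhi
  rw [h5, h6]
  linear_combination (z ^ (-s)) * h4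

lemma afe_norm_cpow (s : ℂ) {z : ℂ} (hz : z ≠ 0) :
    ‖z ^ (-s)‖ = ‖z‖ ^ (-s.re) * Real.exp (s.im * z.arg) := by
  rw [Complex.norm_cpow_of_ne_zero hz, div_eq_mul_inv, ← Real.exp_neg]
  congr 2
  simp; ring

lemma afe_arg_le_div {z : ℂ} (hre : 0 < z.re) (him : 0 ≤ z.im) : z.arg ≤ z.im / z.re := by
  have h0 : 0 ≤ z.arg := Complex.arg_nonneg_iff.mpr him
  have h1 : z.arg < π / 2 := by
    refine lt_of_le_of_lt (le_abs_self _) (Complex.abs_arg_lt_pi_div_two_iff.mpr (Or.inl hre))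
  rw [← Complex.tan_arg]
  exact Real.le_tan h0 h1

lemma afe_rpow_le {x M σ : ℝ} (hx : 1 ≤ x) (hσ : |σ| ≤ M) : x ^ (-σ) ≤ x ^ M :=
  Real.rpow_le_rpow_of_exponent_le hx ((neg_le_abs σ).trans hσ)

def afeFull (s : ℂ) (k : ℝ) : ℂ :=
  Complex.I * Complex.I ^ (-s) * ((1 / ((2 * π * k : ℝ) : ℂ)) ^ (1 - s) * Complex.Gamma (1 - s))

lemma afe_decay {s : ℂ} (ht : 0 < s.im) {k a Y : ℝ} (ha : 0 ≤ a) (hY : 1 ≤ Y) {z : ℂ}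
    (h1 : 0 ≤ z.re) (h2 : z.re ≤ Y + a) (h3 : z.im = Y) :
    ‖z ^ (-s) * Complex.exp (2 * π * Complex.I * k * z)‖ ≤
      ((2 + a) ^ |s.re| * Real.exp (s.im * (π / 2))) * (Y ^ |s.re| * Real.exp (-(2 * π * k) * Y)) := by
  have hz : z ≠ 0 := by
    intro h; rw [h] at h3; simp at h3; linarith
  have hn1 : 1 ≤ ‖z‖ := by
    have := Complex.abs_im_le_norm z
    rw [h3, abs_of_pos (by linarith)] at this
    linarith
  have hn2 : ‖z‖ ≤ (2 + a) * Y := by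
    have := Complex.norm_le_abs_re_add_abs_im z
    rw [h3, abs_of_pos (show 0 < Y by linarith), abs_of_nonneg h1] at this
    nlinarith
  have harg : z.arg ≤ π / 2 := Complex.arg_le_pi_div_two_iff.mpr (Or.inl h1)
  rw [norm_mul, afe_norm_cpow s hz, Complex.norm_exp]
  have he : (2 * π * Complex.I * k * z).re = -(2 * π * k) * Y := by
    rw [← h3]; simp
  rw [he]
  have hr : ‖z‖ ^ (-s.re) ≤ (2 + a) ^ |s.re| * Y ^ |s.re| := by
    rw [← Real.mul_rpow (by linarith) (by linarith)]
    exact (afe_rpow_le hn1 le_rfl).trans (Real.rpow_le_rpow (by linarith) hn2 (abs_nonneg _))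
  have he2 : Real.exp (s.im * z.arg) ≤ Real.exp (s.im * (π / 2)) := by gcongr
  calc ‖z‖ ^ (-s.re) * Real.exp (s.im * z.arg) * Real.exp (-(2 * π * k) * Y)
      ≤ ((2 + a) ^ |s.re| * Y ^ |s.re|) * Real.exp (s.im * (π / 2)) * Real.exp (-(2 * π * k) * Y) := by
        gcongr
    _ = _ := by ring

lemma afe_I_mul_cpow (s : ℂ) {Y : ℝ} (hY : 0 < Y) :
    (Complex.I * Y) ^ s = Complex.I ^ s * (Y:ℂ) ^ s := by
  have hY' : (Y:ℂ) ≠ 0 := by exact_mod_cast hY.ne'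
  rw [Complex.cpow_def_of_ne_zero (by simp [hY']), Complex.cpow_def_of_ne_zero Complex.I_ne_zero,
    Complex.cpow_def_of_ne_zero hY', mul_comm Complex.I, Complex.log_ofReal_mul hY Complex.I_ne_zero,
    ← Complex.exp_add, Complex.ofReal_log hY.le]
  congr 1; ring

lemma afe_slit_I {Y : ℝ} (hY : 0 < Y) : Complex.I * (Y:ℂ) ∈ Complex.slitPlane := by
  right; simp [hY.ne']

lemma afePhi_I_tendsto_aux {s : ℂ} (ht : 0 < s.im) (hσ : s.re < 1) {k : ℝ} (hk : 0 < k) :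
    Filter.Tendsto (fun Y : ℝ => afePhi s (2 * π * Complex.I * k) (Complex.I * Y)) Filter.atTop
      (nhds (afeFull s k)) := by
  set f : ℝ → ℂ := fun Y : ℝ => afePhi s (2 * π * Complex.I * k) (Complex.I * Y) with hf
  set f' : ℝ → ℂ := fun Y : ℝ => Complex.I * Complex.I ^ (-s) *
    ((Y:ℂ) ^ ((1 - s) - 1) * Complex.exp (-(((2 * π * k : ℝ):ℂ) * Y))) with hf'
  have hr : 0 < 2 * π * k := by positivity
  have hre : 0 < (1 - s).re := by simp; exact hσ
  have hint := Complex.integral_cpow_mul_exp_neg_mul_Ioi hre hr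
  have hd : ∀ x ∈ Set.Ioi (0:ℝ), HasDerivAt f (f' x) x := by
    intro x hx
    have h1 := afePhi_hasDerivAt ht.ne' (2 * π * Complex.I * k) (afe_slit_I hx)
    have h2 : HasDerivAt (fun Y : ℝ => Complex.I * (Y:ℂ)) (Complex.I * 1) x :=
      (Complex.ofRealCLM.hasDerivAt (x := x)).const_mul Complex.I
    have h3 := h1.comp x h2
    refine h3.congr_deriv ?_
    simp only [hf']
    rw [afe_I_mul_cpow _ hx]
    have e1 : 2 * π * Complex.I * k * (Complex.I * x) = -(((2 * π * k : ℝ):ℂ) * x) := by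
      push_cast
      linear_combination (2 * π * k * x) * Complex.I_mul_I
    have e2 : 1 - s - 1 = -s := by ring
    rw [e1, e2]; ring
  have hi : IntegrableOn f' (Set.Ioi 0) volume := by
    refine Integrable.const_mul ?_ _
    refine Integrable.of_integral_ne_zero ?_
    rw [hint]
    refine mul_ne_zero ?_ (Complex.Gamma_ne_zero_of_re_pos hre)
    rw [Complex.cpow_def_of_ne_zero]
    · exact Complex.exp_ne_zero _
    · have : ((2 * π * k : ℝ) : ℂ) ≠ 0 := by exact_mod_cast hr.ne'
      simpa using this
  have hc : ContinuousWithinAt f (Set.Ici 0) 0 := by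
    apply ContinuousAt.continuousWithinAt
    have h1 : ContinuousAt (fun z : ℂ => z ^ (1 - s)) (Complex.I * ((0:ℝ):ℂ)) :=
      Complex.continuousAt_cpow_const_of_re_pos (Or.inl (by simp)) hre
    have h2 : ContinuousAt (afeP s) (2 * π * Complex.I * k * (Complex.I * ((0:ℝ):ℂ))) :=
      (afeP_hasDerivAt ht.ne' _).continuousAt
    have h3 : ContinuousAt (fun Y : ℝ => Complex.I * (Y:ℂ)) 0 := by fun_prop
    have h4 : ContinuousAt (fun Y : ℝ => 2 * π * Complex.I * k * (Complex.I * (Y:ℂ))) 0 := by fun_prop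
    exact (ContinuousAt.comp (f := fun Y : ℝ => Complex.I * (Y:ℂ)) (x := 0) h1 h3).mul
      (ContinuousAt.comp (f := fun Y : ℝ => 2 * π * Complex.I * k * (Complex.I * (Y:ℂ))) (x := 0) h2 h4)
  have hlim := tendsto_limUnder_of_hasDerivAt_of_integrableOn_Ioi hd hi
  have key := integral_Ioi_of_hasDerivAt_of_tendsto hc hd hi hlim
  have h0 : f 0 = 0 := by
    simp only [hf, afePhi]
    have : (1 - s) ≠ 0 := by intro h; rw [h] at hre; simp at hre
    simp [Complex.zero_cpow this]
  rw [h0, sub_zero] at key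
  rw [← key] at hlim
  convert hlim using 2
  simp only [hf', afeFull]
  rw [integral_const_mul, hint]

lemma afeFull_rec {s : ℂ} (hs : s.im ≠ 0) {k : ℝ} (hk : 0 < k) :
    s * afeFull (s + 1) k = (2 * π * Complex.I * k) * afeFull s k := by
  have hr : 0 < 2 * π * k := by positivity
  have hr' : ((2 * π * k : ℝ) : ℂ) ≠ 0 := by exact_mod_cast hr.ne'
  have hs0 : s ≠ 0 := by rintro rfl; simp at hs
  unfold afeFull
  have e1 : Complex.I ^ (-(s + 1)) = Complex.I ^ (-s) * (-Complex.I) := by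
    rw [neg_add, Complex.cpow_add _ _ Complex.I_ne_zero, Complex.cpow_neg_one, Complex.inv_I]
  have e2 : (1 / ((2 * π * k : ℝ) : ℂ)) ^ (1 - s)
      = (1 / ((2 * π * k : ℝ) : ℂ)) * (1 / ((2 * π * k : ℝ) : ℂ)) ^ (1 - (s + 1)) := by
    have : 1 - s = 1 + (1 - (s + 1)) := by ring
    rw [this, Complex.cpow_add _ _ (by simpa using hr'), Complex.cpow_one]
  have e3 : Complex.Gamma (1 - s) = -s * Complex.Gamma (1 - (s + 1)) := by
    have := Complex.Gamma_add_one (-s) (neg_ne_zero.mpr hs0)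
    have h1 : 1 - s = -s + 1 := by ring
    have h2 : 1 - (s + 1) = -s := by ring
    rw [h1, h2, this]
  rw [e1, e2, e3]
  have e4 : (2 * (π:ℂ) * Complex.I * k) * (1 / ((2 * π * k : ℝ) : ℂ)) = Complex.I := by
    have hk' : (k:ℂ) ≠ 0 := by exact_mod_cast hk.ne'
    push_cast at hr' ⊢
    field_simp
  linear_combination (s * Complex.I * Complex.I ^ (-s) * (1 / ((2 * π * k : ℝ) : ℂ)) ^ (1 - (s + 1)) *
    Complex.Gamma (1 - (s + 1))) * e4

lemma afe_tendsto_decay (k M D : ℝ) (hk : 0 < k) :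
    Filter.Tendsto (fun Y : ℝ => D * (Y ^ M * Real.exp (-(2 * π * k) * Y))) Filter.atTop (nhds 0) := by
  have := (tendsto_rpow_mul_exp_neg_mul_atTop_nhds_zero M (2 * π * k) (by positivity)).const_mul D
  simpa using this

lemma afePhi_I_tendsto (n : ℕ) : ∀ {s : ℂ}, 0 < s.im → s.re < n + 1 → ∀ {k : ℝ}, 0 < k →
    Filter.Tendsto (fun Y : ℝ => afePhi s (2 * π * Complex.I * k) (Complex.I * Y)) Filter.atTop
      (nhds (afeFull s k)) := by
  induction n with
  | zero => intro s hs hσ k hk; exact afePhi_I_tendsto_aux hs (by simpa using hσ) hk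
  | succ n ih =>
    intro s hs hσ k hk
    have him : 0 < (s - 1).im := by simpa using hs
    have hs0 : s - 1 ≠ 0 := by intro h; rw [h] at him; simp at him
    have h1 := ih (s := s - 1) him (by simp; push_cast at hσ; linarith) hk
    have h2 := afeFull_rec him.ne' hk
    rw [sub_add_cancel] at h2
    have h3 : Filter.Tendsto (fun Y : ℝ => (Complex.I * Y) ^ (-(s-1)) *
        Complex.exp (2 * π * Complex.I * k * (Complex.I * Y))) Filter.atTop (nhds 0) := by
      refine squeeze_zero_norm' ?_ (afe_tendsto_decay k |(s-1).re|
        ((2 + 0) ^ |(s-1).re| * Real.exp ((s-1).im * (π / 2))) hk)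
      filter_upwards [Filter.eventually_ge_atTop 1] with Y hY
      exact afe_decay him le_rfl hY (by simp) (by simp; linarith) (by simp)
    have h4 := ((h3.neg.add (h1.const_mul (2 * π * Complex.I * k))).const_mul ((s-1)⁻¹))
    have h5 : (s-1)⁻¹ * (-0 + 2 * π * Complex.I * k * afeFull (s-1) k) = afeFull s k := by
      rw [← h2]; field_simp; ring
    rw [h5] at h4
    refine h4.congr' ?_
    filter_upwards [Filter.eventually_ge_atTop 1] with Y hY
    have hY' : (Y:ℂ) ≠ 0 := by exact_mod_cast (show Y ≠ 0 by linarith)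
    have h6 := afePhi_rec him.ne' (2 * π * Complex.I * k) (z := Complex.I * Y) (by simp [hY'])
    rw [sub_add_cancel] at h6
    rw [← h6]; field_simp

lemma afePhi_tendsto {s : ℂ} (ht : 0 < s.im) {k : ℝ} (hk : 0 < k) {a : ℝ} (ha : 0 ≤ a)
    (p : ℝ → ℝ) (hp0 : ∀ Y, 0 ≤ Y → 0 ≤ p Y) (hp1 : ∀ Y, 0 ≤ Y → p Y ≤ Y + a) :
    Filter.Tendsto (fun Y : ℝ => afePhi s (2 * π * Complex.I * k) (p Y + Complex.I * Y)) Filter.atTop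
      (nhds (afeFull s k)) := by
  obtain ⟨n, hn⟩ := exists_nat_gt s.re
  have h1 := afePhi_I_tendsto n ht (by linarith) hk
  set c : ℂ := 2 * π * Complex.I * k with hc
  set D := ((2 + a) ^ |s.re| * Real.exp (s.im * (π / 2))) with hD
  have hD0 : 0 ≤ D := by positivity
  have h2 : Filter.Tendsto (fun Y : ℝ => afePhi s c (p Y + Complex.I * Y) - afePhi s c (Complex.I * Y))
      Filter.atTop (nhds 0) := by
    refine squeeze_zero_norm' ?_ (afe_tendsto_decay k (|s.re| + 1) (D * (1 + a)) hk)
    filter_upwards [Filter.eventually_ge_atTop 1] with Y hY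
    have hY0 : 0 ≤ Y := by linarith
    have hder : ∀ x ∈ Set.Icc 0 (p Y), HasDerivWithinAt (fun x : ℝ => afePhi s c (x + Complex.I * Y))
        (((x:ℂ) + Complex.I * Y) ^ (-s) * Complex.exp (c * (x + Complex.I * Y))) (Set.Icc 0 (p Y)) x := by
      intro x hx
      apply HasDerivAt.hasDerivWithinAt
      have hsl : (x:ℂ) + Complex.I * Y ∈ Complex.slitPlane := by
        right; simp; linarith
      have h3 : HasDerivAt (fun x : ℝ => (x:ℂ) + Complex.I * Y) 1 x :=
        (Complex.ofRealCLM.hasDerivAt (x := x)).add_const _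
      have h4 := (afePhi_hasDerivAt ht.ne' c hsl).comp x h3
      rw [mul_one] at h4
      exact h4
    have hb : ∀ x ∈ Set.Icc 0 (p Y), ‖((x:ℂ) + Complex.I * Y) ^ (-s) * Complex.exp (c * (x + Complex.I * Y))‖
        ≤ D * (Y ^ |s.re| * Real.exp (-(2 * π * k) * Y)) := by
      intro x hx
      refine afe_decay ht ha hY ?_ ?_ ?_
      · simp; exact hx.1
      · simp; exact hx.2.trans (hp1 Y hY0)
      · simp
    have h5 := Convex.norm_image_sub_le_of_norm_hasDerivWithin_le hder hb (convex_Icc _ _)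
      (Set.left_mem_Icc.mpr (hp0 Y hY0)) (Set.right_mem_Icc.mpr (hp0 Y hY0))
    simp only [Complex.ofReal_zero, zero_add, sub_zero] at h5
    refine h5.trans ?_
    rw [Real.norm_of_nonneg (hp0 Y hY0), Real.rpow_add (by linarith), Real.rpow_one]
    have h6 : p Y ≤ (1 + a) * Y := by
      have := hp1 Y hY0
      nlinarith
    calc D * (Y ^ |s.re| * Real.exp (-(2 * π * k) * Y)) * p Y
        ≤ D * (Y ^ |s.re| * Real.exp (-(2 * π * k) * Y)) * ((1 + a) * Y) := by gcongr
      _ = _ := by ring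
  have h3 := h2.add h1
  simpa using h3

lemma afe_expo_bound {f f' : ℝ → ℂ} {R D l : ℝ} (hR : 0 ≤ R) (hl : 0 < l) (hD : 0 ≤ D)
    (hd : ∀ x ∈ Set.Icc 0 R, HasDerivAt f (f' x) x)
    (hb : ∀ x ∈ Set.Ico 0 R, ‖f' x‖ ≤ D * Real.exp (-(l * x))) : ‖f R - f 0‖ ≤ D / l := by
  have hB : ∀ x : ℝ, HasDerivAt (fun x : ℝ => D / l * (1 - Real.exp (-(l * x))))
      (D * Real.exp (-(l * x))) x := by
    intro x
    have h1 : HasDerivAt (fun x : ℝ => -(l * x)) (-(l * 1)) x := ((hasDerivAt_id x).const_mul l).neg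
    have h2 := (h1.exp.const_sub 1).const_mul (D / l)
    refine h2.congr_deriv ?_
    field_simp
  have key := image_norm_le_of_norm_deriv_right_le_deriv_boundary (f := fun x => f x - f 0) (f' := f')
    (a := 0) (b := R) (B := fun x : ℝ => D / l * (1 - Real.exp (-(l * x))))
    (fun x hx => ((hd x hx).continuousAt.sub continuousAt_const).continuousWithinAt)
    (fun x hx => ((hd x ⟨hx.1, hx.2.le⟩).sub_const _).hasDerivWithinAt)
    (by simp) hB hb (Set.right_mem_Icc.mpr hR)
  refine key.trans ?_
  have : 0 < Real.exp (-(l * R)) := Real.exp_pos _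
  have h0 : 0 ≤ D / l := by positivity
  nlinarith

lemma afe_rpow_split {x a σ : ℝ} (hx : 0 < x) (ha : 0 < a) : x ^ (-σ) = a ^ (-σ) * (x / a) ^ (-σ) := by
  rw [← Real.mul_rpow ha.le (by positivity)]
  congr 1
  field_simp

lemma afe_rpow_le_up {x a σ M L : ℝ} (ha : 0 < a) (hx : a ≤ x) (hL : x / a ≤ L) (hσ : |σ| ≤ M) :
    x ^ (-σ) ≤ a ^ (-σ) * L ^ M := by
  have h1 : 1 ≤ x / a := by rwa [one_le_div ha]
  have hM : 0 ≤ M := (abs_nonneg _).trans hσ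
  rw [afe_rpow_split (by linarith) ha]
  gcongr
  exact (afe_rpow_le h1 hσ).trans (Real.rpow_le_rpow (by linarith) hL hM)

lemma afe_rpow_le_down {x a σ M : ℝ} (ha : 0 < a) (h1 : a / 2 ≤ x) (h2 : x ≤ a) (hσ : |σ| ≤ M) :
    x ^ (-σ) ≤ a ^ (-σ) * 2 ^ M := by
  have hM : 0 ≤ M := (abs_nonneg _).trans hσ
  have hx : 0 < x := by linarith
  rw [afe_rpow_split hx ha]
  gcongr
  have h3 : (x / a) ^ (-σ) = (a / x) ^ (-(-σ)) := by
    rw [Real.rpow_neg (by positivity), ← Real.inv_rpow (by positivity), inv_div, neg_neg]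
  rw [h3]
  have h4 : 1 ≤ a / x := by rwa [one_le_div hx]
  refine (afe_rpow_le h4 (M := M) (by rwa [abs_neg])).trans (Real.rpow_le_rpow (by linarith) ?_ hM)
  rw [div_le_iff₀ hx]; linarith

lemma afe_arctan_lower {v : ℝ} (h0 : 0 ≤ v) (h1 : v < 1) :
    v + v ^ 2 / 3 ≤ Real.arctan (v / (1 - v)) := by
  have hd : ∀ x ∈ Set.Icc 0 v, HasDerivAt (fun x : ℝ => Real.arctan (x / (1 - x)) - (x + x ^ 2 - 2 * x ^ 3 / 3))
      (1 / (1 - 2 * x + 2 * x ^ 2) - (1 + 2 * x - 2 * x ^ 2)) x := by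
    intro x hx
    have hx1 : 1 - x ≠ 0 := by have := hx.2; intro h; linarith
    have e1 : HasDerivAt (fun x : ℝ => x / (1 - x)) ((1 * (1 - x) - x * (-1)) / (1 - x) ^ 2) x :=
      (hasDerivAt_id x).div ((hasDerivAt_id x).const_sub 1) hx1
    have e2 := e1.arctan
    have e3 : HasDerivAt (fun x : ℝ => x + x ^ 2 - 2 * x ^ 3 / 3) (1 + 2 * x - 2 * x ^ 2) x := by
      have := ((hasDerivAt_id x).add (hasDerivAt_pow 2 x)).sub
        (((hasDerivAt_pow 3 x).const_mul 2).div_const 3)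
      refine this.congr_deriv ?_
      push_cast; ring
    refine (e2.sub e3).congr_deriv ?_
    congr 1
    have h2 : (1 - x) ^ 2 + x ^ 2 ≠ 0 := by positivity
    have h3 : 1 + (x / (1 - x)) ^ 2 = ((1 - x) ^ 2 + x ^ 2) / (1 - x) ^ 2 := by field_simp
    have h4 : 1 - 2 * x + 2 * x ^ 2 = (1 - x) ^ 2 + x ^ 2 := by ring
    rw [h3, h4]
    field_simp
    ring
  have hmono : MonotoneOn (fun x : ℝ => Real.arctan (x / (1 - x)) - (x + x ^ 2 - 2 * x ^ 3 / 3)) (Set.Icc 0 v) := by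
    apply monotoneOn_of_deriv_nonneg (convex_Icc _ _)
    · exact fun x hx => (hd x hx).continuousAt.continuousWithinAt
    · intro x hx
      rw [interior_Icc] at hx
      exact (hd x ⟨hx.1.le, hx.2.le⟩).differentiableAt.differentiableWithinAt
    · intro x hx
      rw [interior_Icc] at hx
      rw [(hd x ⟨hx.1.le, hx.2.le⟩).deriv]
      have h2 : 0 < 1 - 2 * x + 2 * x ^ 2 := by nlinarith [sq_nonneg (2 * x - 1)]
      rw [sub_nonneg, le_div_iff₀ h2]
      nlinarith [sq_nonneg (2 * x - 2 * x ^ 2)]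
  have := hmono (Set.left_mem_Icc.mpr h0) (Set.right_mem_Icc.mpr h0) h0
  simp at this
  nlinarith [mul_nonneg (sq_nonneg v) (sub_nonneg.mpr h1.le)]

def afeSeg (a u : ℝ) : ℂ := (a : ℂ) - (a * u : ℝ) - Complex.I * (a * u : ℝ)

lemma afeSeg_re (a u : ℝ) : (afeSeg a u).re = a * (1 - u) := by simp [afeSeg]; ring
lemma afeSeg_im (a u : ℝ) : (afeSeg a u).im = -(a * u) := by simp [afeSeg]

lemma afeSeg_arg {a u : ℝ} (ha : 0 < a) (h0 : 0 ≤ u) (h1 : u < 1) :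
    (afeSeg a u).arg ≤ -(u + u ^ 2 / 3) := by
  have hre : 0 < (afeSeg a u).re := by rw [afeSeg_re]; nlinarith
  have h2 := Complex.abs_arg_lt_pi_div_two_iff.mpr (Or.inl hre)
  have h3 := Complex.tan_arg (afeSeg a u)
  rw [abs_lt] at h2
  have h4 := Real.arctan_tan h2.1 h2.2
  rw [h3, afeSeg_re, afeSeg_im] at h4
  have h5 : -(a * u) / (a * (1 - u)) = -(u / (1 - u)) := by
    have : 1 - u ≠ 0 := by intro h; linarith
    field_simp
  rw [h5, Real.arctan_neg] at h4
  have := afe_arctan_lower h0 h1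
  linarith

lemma afeSeg_slit {a u : ℝ} (ha : 0 < a) (h0 : 0 ≤ u) (h1 : u ≤ 1) : afeSeg a u ∈ Complex.slitPlane := by
  rcases h1.lt_or_eq with h | h
  · left; rw [afeSeg_re]; nlinarith
  · right; rw [afeSeg_im, h]; simp; exact ha.ne'

lemma afeSeg_norm {a u : ℝ} (ha : 0 < a) (h0 : 0 ≤ u) (h1 : u ≤ 1) :
    a / 2 ≤ ‖afeSeg a u‖ ∧ ‖afeSeg a u‖ ≤ a := by
  have h : ‖afeSeg a u‖ ^ 2 = a ^ 2 * ((1 - u) ^ 2 + u ^ 2) := by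
    rw [← Complex.normSq_eq_norm_sq, Complex.normSq_apply, afeSeg_re, afeSeg_im]; ring
  constructor
  · refine abs_le_of_sq_le_sq' ?_ (norm_nonneg _) |>.2
    rw [h]; nlinarith [sq_nonneg (2 * u - 1), sq_nonneg a]
  · refine abs_le_of_sq_le_sq' ?_ ha.le |>.2
    rw [h]; nlinarith [mul_nonneg h0 (sub_nonneg.mpr h1), sq_nonneg a]

lemma afeSeg_cpow {s : ℂ} {M a u : ℝ} (ht : 0 < s.im) (hM : |s.re| ≤ M) (ha : 0 < a) (h0 : 0 ≤ u) (h1 : u < 1) :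
    ‖afeSeg a u ^ (-s)‖ ≤ a ^ (-s.re) * 2 ^ M * Real.exp (-(s.im * (u + u ^ 2 / 3))) := by
  rw [afe_norm_cpow s (Complex.slitPlane_ne_zero (afeSeg_slit ha h0 h1.le))]
  have h2 := afeSeg_norm ha h0 h1.le
  have h3 := afe_rpow_le_down ha h2.1 h2.2 hM
  have h4 := afeSeg_arg ha h0 h1
  have h5 : s.im * (afeSeg a u).arg ≤ -(s.im * (u + u ^ 2 / 3)) := by nlinarith
  gcongr

lemma afe_seg_bound {s : ℂ} {M a : ℝ} (ht : 0 < s.im) (hM : |s.re| ≤ M) (ha : 0 < a) (K : ℕ)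
    (hG : ∀ u : ℝ, 0 ≤ u → u < 1 → ‖∑ k ∈ Finset.Icc 1 K, Complex.exp (2 * π * Complex.I * (k:ℝ) * afeSeg a u)‖
      ≤ 4 * Real.exp (2 * π * K * a * u))
    (hK : 2 * π * K * a ≤ s.im + 3 / 2 * √s.im) :
    ‖(∑ k ∈ Finset.Icc 1 K, afePhi s (2 * π * Complex.I * (k:ℝ)) (-Complex.I * a)) -
      ∑ k ∈ Finset.Icc 1 K, afePhi s (2 * π * Complex.I * (k:ℝ)) a‖ ≤
      (8 * 2 ^ M * Real.exp 5) * (a * a ^ (-s.re) / √s.im) := by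
  set f : ℝ → ℂ := fun u => ∑ k ∈ Finset.Icc 1 K, afePhi s (2 * π * Complex.I * (k:ℝ)) (afeSeg a u) with hf
  set f' : ℝ → ℂ := fun u => ∑ k ∈ Finset.Icc 1 K, ((afeSeg a u) ^ (-s) *
    Complex.exp (2 * π * Complex.I * (k:ℝ) * afeSeg a u) * (-(a:ℂ) * (1 + Complex.I))) with hf'
  have hsq : 0 < √s.im := Real.sqrt_pos.mpr ht
  have key := afe_expo_bound (f := f) (f' := f') (R := 1) (D := 8 * 2 ^ M * Real.exp 5 * (a * a ^ (-s.re)))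
    (l := √s.im) zero_le_one hsq (by positivity) ?_ ?_
  · have e1 : f 1 = ∑ k ∈ Finset.Icc 1 K, afePhi s (2 * π * Complex.I * (k:ℝ)) (-Complex.I * a) := by
      simp [hf, afeSeg]
    have e0 : f 0 = ∑ k ∈ Finset.Icc 1 K, afePhi s (2 * π * Complex.I * (k:ℝ)) a := by
      simp [hf, afeSeg]
    rw [e1, e0] at key
    refine key.trans (le_of_eq ?_)
    ring
  · intro u hu
    refine HasDerivAt.fun_sum fun k _ => ?_
    have h1 := afePhi_hasDerivAt ht.ne' (2 * π * Complex.I * (k:ℝ)) (afeSeg_slit ha hu.1 hu.2)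
    have h2 : HasDerivAt (fun u : ℝ => afeSeg a u) (-(a:ℂ) * (1 + Complex.I)) u := by
      have e : HasDerivAt (fun u : ℝ => ((a * u : ℝ) : ℂ)) (a:ℂ) u := by
        have := ((hasDerivAt_id u).const_mul a).ofReal_comp
        simpa using this
      refine ((e.const_sub (a:ℂ)).sub (e.const_mul Complex.I)).congr_deriv ?_
      ring
    exact h1.comp u h2
  · intro u hu
    simp only [hf']
    have e : (∑ k ∈ Finset.Icc 1 K, ((afeSeg a u) ^ (-s) *
      Complex.exp (2 * π * Complex.I * (k:ℝ) * afeSeg a u) * (-(a:ℂ) * (1 + Complex.I))))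
      = (afeSeg a u) ^ (-s) * (∑ k ∈ Finset.Icc 1 K, Complex.exp (2 * π * Complex.I * (k:ℝ) * afeSeg a u)) *
        (-(a:ℂ) * (1 + Complex.I)) := by
      rw [Finset.mul_sum, Finset.sum_mul]
    rw [e, norm_mul, norm_mul]
    have h3 : ‖-(a:ℂ) * (1 + Complex.I)‖ ≤ 2 * a := by
      rw [norm_mul, norm_neg, Complex.norm_of_nonneg ha.le, mul_comm]
      gcongr
      refine (norm_add_le _ _).trans ?_
      simp; norm_num
    have h4 := afeSeg_cpow ht hM ha hu.1 hu.2
    have h5 := hG u hu.1 hu.2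
    have h6 : Real.exp (-(s.im * (u + u ^ 2 / 3))) * Real.exp (2 * π * K * a * u) ≤
        Real.exp 5 * Real.exp (-(√s.im * u)) := by
      rw [← Real.exp_add, ← Real.exp_add]
      apply Real.exp_le_exp.mpr
      have h7 : √s.im ^ 2 = s.im := Real.sq_sqrt ht.le
      have h8 : 2 * π * K * a * u ≤ (s.im + 3 / 2 * √s.im) * u := by
        have := hu.1; gcongr
      have h9 : s.im * u ^ 2 = (√s.im * u) ^ 2 := by rw [mul_pow, h7]
      nlinarith [sq_nonneg (√s.im * u - 15/4)]
    calc _ ≤ (a ^ (-s.re) * 2 ^ M * Real.exp (-(s.im * (u + u ^ 2 / 3)))) * (4 * Real.exp (2 * π * K * a * u)) * (2 * a) := by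
          gcongr
      _ = (8 * 2 ^ M * (a * a ^ (-s.re))) * (Real.exp (-(s.im * (u + u ^ 2 / 3))) * Real.exp (2 * π * K * a * u)) := by ring
      _ ≤ (8 * 2 ^ M * (a * a ^ (-s.re))) * (Real.exp 5 * Real.exp (-(√s.im * u))) := by gcongr
      _ = _ := by ring

lemma afe_poly_exp {w M : ℝ} (hw : 0 ≤ w) (hM : 1 ≤ M) :
    (1 + 2 * w) ^ M ≤ (4 * M + 1) ^ M * Real.exp (w / 2) := by
  have h1 : 1 + 2 * w ≤ (4 * M + 1) * Real.exp (w / (2 * M)) := by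
    have h2 := Real.add_one_le_exp (w / (2 * M))
    have h3 : (4 * M + 1) * (w / (2 * M) + 1) = 2 * w + w / (2 * M) + 4 * M + 1 := by
      field_simp; ring
    have h4 : 0 ≤ w / (2 * M) := by positivity
    have h5 : (4 * M + 1) * (w / (2 * M) + 1) ≤ (4 * M + 1) * Real.exp (w / (2 * M)) := by gcongr
    linarith
  have h2 := Real.rpow_le_rpow (z := M) (by positivity) h1 (by linarith)
  rw [Real.mul_rpow (by positivity) (by positivity), ← Real.exp_mul] at h2
  have h3 : w / (2 * M) * M = w / 2 := by field_simp
  rwa [h3] at h2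

lemma afe_ray_exponent {a α β k t U : ℝ} (ha : 1 / 2 ≤ a) (hα : α ≤ a + 1 / 2)
    (hβ1 : 1 ≤ β) (hβ2 : β ≤ 2 * a) (hk : β ≤ k) (ht : t = 2 * π * α * β) (hU : 0 ≤ U) :
    t * (U / (a + U)) - 2 * π * k * U ≤ π / 2 + 1 - √(π * β * a) * U / a := by
  have haU : 0 < a + U := by linarith
  have ha0 : 0 < a := by linarith
  have hpi := Real.pi_gt_three
  have hT : 1 ≤ π * β * a := by
    have : (1:ℝ) * (1/2) ≤ β * a := by gcongr
    nlinarith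
  set T := π * β * a with hTd
  have hr1 : 1 ≤ √T := Real.one_le_sqrt.mpr hT
  have hr2 : √T ^ 2 = T := Real.sq_sqrt (by linarith)
  set r := √T
  have e1 : 2 * π * β * U ≤ 2 * π * k * U := by gcongr
  have e2 : t * (U / (a + U)) - 2 * π * β * U = 2 * π * β * U * (α - a - U) / (a + U) := by
    rw [ht]; field_simp
    ring
  have e3 : 2 * π * β * U * (α - a - U) / (a + U) ≤ π * β * (1 / 4 - U ^ 2) / (a + U) := by
    gcongr ?_ / _
    have h1 : 2 * π * β * U * (α - a - U) ≤ 2 * π * β * U * (1 / 2 - U) := by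
      gcongr; linarith
    have h2 : 0 ≤ π * β * (U - 1 / 2) ^ 2 := by positivity
    nlinarith
  have e4 : π * β * (1 / 4 - U ^ 2) / (a + U) ≤ π / 2 - π * β * U ^ 2 / (a + U) := by
    have h1 : π * β * (1 / 4) / (a + U) ≤ π / 2 := by
      rw [div_le_iff₀ haU]
      nlinarith
    have : π * β * (1 / 4 - U ^ 2) / (a + U) = π * β * (1 / 4) / (a + U) - π * β * U ^ 2 / (a + U) := by ring
    linarith
  have e5 : r * U / a - 1 ≤ π * β * U ^ 2 / (a + U) := by
    have h0 : π * β = r ^ 2 / a := by rw [hr2, hTd]; field_simp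
    rw [h0, le_div_iff₀ haU]
    have h1 : (r * U / a - 1) * (a + U) = r * U + r * U ^ 2 / a - a - U := by field_simp; ring
    rw [h1]
    have h2 : r ^ 2 / a * U ^ 2 - (r * U + r * U ^ 2 / a - a - U) =
      ((r * U) * ((r - 1) * U) + a ^ 2 - (r - 1) * U * a) / a := by field_simp; ring
    have h3 : 0 ≤ ((r * U) * ((r - 1) * U) + a ^ 2 - (r - 1) * U * a) / a := by
      apply div_nonneg _ ha0.le
      have h5 : 0 ≤ (r - 1) * U := mul_nonneg (by linarith) hU
      have h6 : ((r - 1) * U) * ((r - 1) * U) ≤ (r * U) * ((r - 1) * U) := by gcongr; linarith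
      nlinarith [sq_nonneg ((r - 1) * U - a), sq_nonneg ((r - 1) * U), sq_nonneg a]
    linarith
  linarith

lemma afe_ray_bound {s : ℂ} {M a α β k : ℝ} (ht : 0 < s.im) (hM1 : 1 ≤ M) (hM : |s.re| ≤ M)
    (ha : 1 / 2 ≤ a) (hα : α ≤ a + 1 / 2)
    (hβ1 : 1 ≤ β) (hβ2 : β ≤ 2 * a) (hk : β ≤ k) (hts : s.im = 2 * π * α * β) :
    ‖afeFull s k - afePhi s (2 * π * Complex.I * k) a‖ ≤
      (8 * (4 * M + 1) ^ M * Real.exp 3) * (a * a ^ (-s.re) / √s.im) := by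
  have ha0 : 0 < a := by linarith
  have hpi := Real.pi_gt_three
  have hk0 : 0 < k := by linarith
  have hT : 1 ≤ π * β * a := by
    have : (1:ℝ) * (1/2) ≤ β * a := by gcongr
    nlinarith
  have hr1 : 1 ≤ √(π * β * a) := Real.one_le_sqrt.mpr hT
  set f : ℝ → ℂ := fun U => afePhi s (2 * π * Complex.I * k) (((a + U : ℝ) : ℂ) + Complex.I * U) with hf
  set f' : ℝ → ℂ := fun U => ((((a + U : ℝ) : ℂ) + Complex.I * U) ^ (-s) *
    Complex.exp ((2 * π * Complex.I * k) * (((a + U : ℝ) : ℂ) + Complex.I * U))) * (1 + Complex.I) with hf'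
  have hlim : Filter.Tendsto f Filter.atTop (nhds (afeFull s k)) :=
    afePhi_tendsto ht hk0 ha0.le (fun U => a + U) (fun U hU => by linarith) (fun U hU => by linarith)
  have hf0 : f 0 = afePhi s (2 * π * Complex.I * k) a := by simp [hf]
  have hre : ∀ U : ℝ, (((a + U : ℝ) : ℂ) + Complex.I * U).re = a + U := by intro U; simp
  have him : ∀ U : ℝ, (((a + U : ℝ) : ℂ) + Complex.I * U).im = U := by intro U; simp
  have hd : ∀ U, 0 ≤ U → HasDerivAt f (f' U) U := by
    intro U hU
    have h1 : HasDerivAt (fun U : ℝ => ((a + U : ℝ) : ℂ) + Complex.I * U) (1 + Complex.I) U := by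
      have h2 : HasDerivAt (fun U : ℝ => ((a + U : ℝ) : ℂ)) ((1:ℝ):ℂ) U :=
        ((hasDerivAt_id U).const_add a).ofReal_comp
      have h3 : HasDerivAt (fun U : ℝ => Complex.I * (U : ℂ)) (Complex.I * ((1:ℝ):ℂ)) U :=
        ((hasDerivAt_id U).ofReal_comp).const_mul _
      exact (h2.add h3).congr_deriv (by simp)
    have h2 := afePhi_hasDerivAt ht.ne' (2 * π * Complex.I * k) (z := ((a + U : ℝ) : ℂ) + Complex.I * U)
      (by left; rw [hre]; linarith)
    exact h2.comp U h1
  have hb : ∀ U, 0 ≤ U → ‖f' U‖ ≤ (2 * a ^ (-s.re) * (4 * M + 1) ^ M * Real.exp 3) *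
      Real.exp (-(√(π * β * a) / (2 * a) * U)) := by
    intro U hU
    set z := ((a + U : ℝ) : ℂ) + Complex.I * U with hz
    have hzre : z.re = a + U := hre U
    have hzim : z.im = U := him U
    have hz0 : z ≠ 0 := by intro h; rw [h] at hzre; simp at hzre; linarith
    have hI : ‖(1 + Complex.I : ℂ)‖ ≤ 2 := by
      refine (norm_add_le _ _).trans ?_; simp; norm_num
    have hn1 : a ≤ ‖z‖ := by
      have := Complex.abs_re_le_norm z
      rw [hzre, abs_of_nonneg (by linarith)] at this; linarith
    have hn2 : ‖z‖ / a ≤ 1 + 2 * (√(π * β * a) * U / a) := by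
      have := Complex.norm_le_abs_re_add_abs_im z
      rw [hzre, hzim, abs_of_nonneg hU, abs_of_nonneg (by linarith)] at this
      rw [div_le_iff₀ ha0]
      have h5 : (1 + 2 * (√(π * β * a) * U / a)) * a = a + 2 * (√(π * β * a) * U) := by field_simp
      rw [h5]; nlinarith
    have hw : 0 ≤ √(π * β * a) * U / a := by positivity
    have hp := afe_rpow_le_up ha0 hn1 hn2 hM
    have hq := afe_poly_exp hw hM1
    have harg := afe_arg_le_div (z := z) (by rw [hzre]; linarith) (by rw [hzim]; exact hU)
    rw [hzre, hzim] at harg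
    have hex := afe_ray_exponent ha hα hβ1 hβ2 hk hts hU
    have h6 : s.im * z.arg ≤ s.im * (U / (a + U)) := by gcongr
    have h7 : (2 * π * Complex.I * k * z).re = -(2 * π * k * U) := by rw [← hzim]; simp
    have hpi4 := Real.pi_lt_four
    have h8 : Real.exp (s.im * z.arg) * Real.exp (-(2 * π * k * U)) ≤
        Real.exp 3 * Real.exp (-(√(π * β * a) * U / a)) := by
      rw [← Real.exp_add, ← Real.exp_add]
      apply Real.exp_le_exp.mpr
      linarith
    rw [hf']
    simp only
    rw [norm_mul, norm_mul, afe_norm_cpow s hz0, Complex.norm_exp, h7]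
    have h9 : Real.exp (√(π * β * a) * U / a / 2) * Real.exp (-(√(π * β * a) * U / a)) =
        Real.exp (-(√(π * β * a) / (2 * a) * U)) := by
      rw [← Real.exp_add]; congr 1; field_simp; ring
    calc ‖z‖ ^ (-s.re) * Real.exp (s.im * z.arg) * Real.exp (-(2 * π * k * U)) * ‖1 + Complex.I‖
        = ‖z‖ ^ (-s.re) * (Real.exp (s.im * z.arg) * Real.exp (-(2 * π * k * U))) * ‖1 + Complex.I‖ := by ring
      _ ≤ (a ^ (-s.re) * ((4 * M + 1) ^ M * Real.exp (√(π * β * a) * U / a / 2))) *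
          (Real.exp 3 * Real.exp (-(√(π * β * a) * U / a))) * 2 := by
          gcongr
          exact hp.trans (by gcongr)
      _ = (2 * a ^ (-s.re) * (4 * M + 1) ^ M * Real.exp 3) *
          (Real.exp (√(π * β * a) * U / a / 2) * Real.exp (-(√(π * β * a) * U / a))) := by ring
      _ = _ := by rw [h9]
  have hfin : ∀ R, 0 ≤ R → ‖f R - f 0‖ ≤
      (2 * a ^ (-s.re) * (4 * M + 1) ^ M * Real.exp 3) / (√(π * β * a) / (2 * a)) := by
    intro R hR
    exact afe_expo_bound hR (by positivity) (by positivity) (fun x hx => hd x hx.1) (fun x hx => hb x hx.1)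
  have hlim2 : Filter.Tendsto (fun R => ‖f R - f 0‖) Filter.atTop (nhds ‖afeFull s k - f 0‖) :=
    (hlim.sub_const _).norm
  have h10 := le_of_tendsto hlim2 (Filter.eventually_atTop.mpr ⟨0, hfin⟩)
  rw [hf0] at h10
  refine h10.trans ?_
  have h11 : √s.im ≤ 2 * √(π * β * a) := by
    rw [Real.sqrt_le_iff]
    refine ⟨by positivity, ?_⟩
    rw [mul_pow, Real.sq_sqrt (by linarith), hts]
    have : α ≤ 2 * a := by linarith
    have : π * β * α ≤ π * β * (2 * a) := by gcongr
    nlinarith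
  have h12 : 0 < √s.im := Real.sqrt_pos.mpr ht
  have h13 : 0 < √(π * β * a) := by linarith
  have h14 : 1 / √(π * β * a) ≤ 2 / √s.im := by
    rw [div_le_div_iff₀ h13 h12]; linarith
  calc _ = (4 * a * a ^ (-s.re) * (4 * M + 1) ^ M * Real.exp 3) * (1 / √(π * β * a)) := by field_simp; ring
    _ ≤ (4 * a * a ^ (-s.re) * (4 * M + 1) ^ M * Real.exp 3) * (2 / √s.im) := by gcongr
    _ = _ := by field_simp; ring

lemma afe_seg_exp (a u : ℝ) (k : ℕ) :
    Complex.exp (2 * π * Complex.I * (k:ℝ) * afeSeg a u) = Complex.exp (2 * π * Complex.I * afeSeg a u) ^ k := by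
  rw [← Complex.exp_nat_mul]; congr 1; push_cast; ring

lemma afe_seg_exp_norm (a u : ℝ) : ‖Complex.exp (2 * π * Complex.I * afeSeg a u)‖ = Real.exp (2 * π * a * u) := by
  rw [Complex.norm_exp]; congr 1
  simp [afeSeg_im]; ring

lemma afe_geom_one (a u : ℝ) (h : 0 ≤ a * u) :
    ‖∑ k ∈ Finset.Icc 1 1, Complex.exp (2 * π * Complex.I * ((k:ℕ):ℝ) * afeSeg a u)‖
      ≤ 4 * Real.exp (2 * π * (1:ℕ) * a * u) := by
  simp only [afe_seg_exp]
  rw [Finset.Icc_self, Finset.sum_singleton, pow_one, afe_seg_exp_norm]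
  have := Real.exp_pos (2 * π * a * u)
  simp only [Nat.cast_one, mul_one]; linarith

lemma afe_geom (a u : ℝ) (ha : Complex.exp (2 * π * Complex.I * a) = -1) (h : 0 ≤ a * u) (K : ℕ) :
    ‖∑ k ∈ Finset.Icc 1 K, Complex.exp (2 * π * Complex.I * ((k:ℕ):ℝ) * afeSeg a u)‖
      ≤ 4 * Real.exp (2 * π * K * a * u) := by
  simp only [afe_seg_exp]
  have hqn := afe_seg_exp_norm a u
  set q := Complex.exp (2 * π * Complex.I * afeSeg a u) with hq
  set w := 2 * π * a * u with hw
  have hw0 : 0 ≤ w := by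
    rw [hw]; have := Real.pi_pos; have h2 : 0 ≤ 2 * π * (a * u) := by positivity
    linarith
  have hq0 : q ≠ 0 := Complex.exp_ne_zero _
  have hqi : 1 - q⁻¹ = 1 + Complex.exp (-w + w * Complex.I) := by
    have : q = -Complex.exp (w - w * Complex.I) := by
      have h1 : 2 * π * Complex.I * afeSeg a u = 2 * π * Complex.I * a + (w - w * Complex.I) := by
        rw [hw, afeSeg]; push_cast
        linear_combination (-2 * π * a * u) * Complex.I_sq
      rw [hq, h1, Complex.exp_add, ha]; ring
    rw [this, inv_neg, ← Complex.exp_neg]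
    rw [sub_neg_eq_add]; congr 2; ring
  have hlow : 1 / 2 ≤ ‖1 - q⁻¹‖ := by
    rw [hqi]
    refine le_trans ?_ (Complex.re_le_norm _)
    rw [Complex.add_re, Complex.exp_re]
    simp only [Complex.one_re, Complex.add_re, Complex.neg_re, Complex.ofReal_re, Complex.mul_re,
      Complex.I_re, Complex.ofReal_im, Complex.I_im, Complex.add_im, Complex.neg_im, Complex.mul_im]
    simp only [mul_zero, mul_one, sub_zero, add_zero, neg_zero, zero_add]
    rcases le_total w (π / 2) with h1 | h1
    · have := Real.cos_nonneg_of_mem_Icc (x := w) ⟨by linarith [Real.pi_pos], h1⟩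
      have := mul_nonneg (Real.exp_pos (-w)).le this
      linarith
    · have h2 : Real.exp (-w) ≤ 1 / 2 := by
        have h3 := Real.add_one_le_exp w
        rw [Real.exp_neg, inv_le_comm₀ (Real.exp_pos _) (by norm_num)]
        have := Real.pi_gt_three
        norm_num; linarith
      have h3 := Real.neg_one_le_cos w
      nlinarith [Real.exp_pos (-w)]
  have htel : (1 - q⁻¹) * ∑ k ∈ Finset.Icc 1 K, q ^ k = q ^ K - 1 := by
    induction K with
    | zero => simp
    | succ n ih =>
      rw [Finset.sum_Icc_succ_top (by omega), mul_add, ih]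
      field_simp; ring
  have hup : ‖q ^ K - 1‖ ≤ 2 * Real.exp (2 * π * K * a * u) := by
    refine (norm_sub_le _ _).trans ?_
    rw [norm_pow, hqn, ← Real.exp_nat_mul, norm_one]
    have e1 : (K:ℝ) * w = 2 * π * K * a * u := by rw [hw]; ring
    rw [e1]
    have : 1 ≤ Real.exp (2 * π * K * a * u) := Real.one_le_exp (by rw [← e1]; positivity)
    linarith
  rw [← htel, norm_mul] at hup
  have := norm_nonneg (∑ k ∈ Finset.Icc 1 K, q ^ k)
  nlinarith

lemma afePhi_negI_bound {s : ℂ} (ht : 0 < s.im) {a k : ℝ} (ha : 0 < a) (hk : 0 ≤ k) :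
    ‖afePhi s (2 * π * Complex.I * k) (-Complex.I * a)‖ ≤
      a * a ^ (-s.re) * Real.exp (2 * π * k * a - π / 2 * s.im) / s.im := by
  have ha' : (a:ℂ) ≠ 0 := by exact_mod_cast ha.ne'
  have hz : -Complex.I * (a:ℂ) ≠ 0 := by simp [ha']
  have hzn : ‖-Complex.I * (a:ℂ)‖ = a := by simp [abs_of_pos ha]
  have harg : (-Complex.I * (a:ℂ)).arg = -(π / 2) := by
    rw [mul_comm, Complex.arg_real_mul _ ha, Complex.arg_neg_I]
  unfold afePhi
  rw [norm_mul]
  have h1 : (1 - s) = -(s - 1) := by ring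
  rw [h1, afe_norm_cpow _ hz, hzn, harg]
  have h2 := afeP_norm_le ht.ne' (2 * π * Complex.I * k * (-Complex.I * a))
  have h3 : ‖2 * π * Complex.I * k * (-Complex.I * (a:ℂ))‖ = 2 * π * k * a := by
    simp [abs_of_pos ha, abs_of_nonneg hk, abs_of_pos Real.pi_pos]
  rw [h3, abs_of_pos ht] at h2
  have h4 : a ^ (-(s - 1).re) = a * a ^ (-s.re) := by
    have : (-(s - 1).re) = 1 + (-s.re) := by simp; ring
    rw [this, Real.rpow_add ha, Real.rpow_one]
  rw [h4]
  calc _ ≤ a * a ^ (-s.re) * Real.exp ((s - 1).im * -(π / 2)) * (Real.exp (2 * π * k * a) / s.im) := by gcongr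
    _ = a * a ^ (-s.re) * (Real.exp (2 * π * k * a) * Real.exp ((s - 1).im * -(π / 2))) / s.im := by ring
    _ = _ := by
      rw [← Real.exp_add]; congr 3; simp; ring

lemma afePhi_negI_sum {s : ℂ} (ht : 1 ≤ s.im) {a : ℝ} (ha : 0 < a) (K : ℕ) (hK : (K:ℝ) ≤ s.im)
    (hKa : 2 * π * K * a ≤ 3 / 2 * s.im) :
    ‖∑ k ∈ Finset.Icc 1 K, afePhi s (2 * π * Complex.I * ((k:ℕ):ℝ)) (-Complex.I * a)‖ ≤
      15 * (a * a ^ (-s.re) / √s.im) := by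
  have ht0 : 0 < s.im := by linarith
  have h1 : ∀ k ∈ Finset.Icc 1 K, ‖afePhi s (2 * π * Complex.I * ((k:ℕ):ℝ)) (-Complex.I * a)‖ ≤
      a * a ^ (-s.re) * Real.exp (-(0.07 * s.im)) / s.im := by
    intro k hk
    have hkK : (k:ℝ) ≤ K := by exact_mod_cast (Finset.mem_Icc.mp hk).2
    refine (afePhi_negI_bound ht0 ha (by positivity)).trans ?_
    gcongr
    have h2 : 2 * π * k * a ≤ 2 * π * K * a := by gcongr
    have h3 := Real.pi_gt_d2
    nlinarith
  refine (norm_sum_le_of_le _ h1).trans ?_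
  rw [Finset.sum_const, nsmul_eq_mul, Nat.card_Icc]
  simp only [Nat.add_sub_cancel]
  have h5 : Real.exp (-(0.07 * s.im)) ≤ 15 / √s.im := by
    have h6 := Real.add_one_le_exp (0.07 * s.im)
    have h7 : √s.im ≤ s.im := by
      rw [Real.sqrt_le_left (by linarith)]; nlinarith
    have h8 : 0 < √s.im := Real.sqrt_pos.mpr ht0
    rw [Real.exp_neg, inv_le_comm₀ (Real.exp_pos _) (by positivity), inv_div]
    rw [div_le_iff₀ (by norm_num)]
    nlinarith
  calc (K:ℝ) * (a * a ^ (-s.re) * Real.exp (-(0.07 * s.im)) / s.im)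
      ≤ s.im * (a * a ^ (-s.re) * (15 / √s.im) / s.im) := by gcongr
    _ = _ := by field_simp

lemma afe_full_one_bound {M : ℝ} (hM1 : 1 ≤ M) : ∃ C : ℝ, 0 ≤ C ∧ ∀ s : ℂ, |s.re| ≤ M → 2 * π ≤ s.im →
    ‖afeFull s 1‖ ≤ C * s.im ^ ((1:ℝ)/2 - s.re) := by
  refine ⟨(8 * (4 * M + 1) ^ M * Real.exp 3 + 8 * 2 ^ M * Real.exp 5 + 15) * (2 * π) ^ M, by positivity, ?_⟩
  intro s hM ht
  have hpi := Real.pi_gt_three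
  have ht0 : 0 < s.im := by linarith
  set a := s.im / (2 * π) with ha
  have ha1 : 1 ≤ a := by rw [ha, one_le_div (by positivity)]; exact ht
  have ha0 : 0 < a := by linarith
  have hat : 2 * π * a = s.im := by rw [ha]; field_simp
  have h1 := afe_ray_bound (s := s) (M := M) (a := a) (α := a) (β := 1) (k := 1) ht0 hM1 hM (by linarith) (by linarith) le_rfl
    (by linarith) le_rfl (by linarith)
  have h2 := afe_seg_bound ht0 hM ha0 1 (fun u h0 _ => afe_geom_one a u (by positivity)) (by
    have := Real.sqrt_nonneg s.im
    simp only [Nat.cast_one, mul_one]; linarith)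
  have h3 := afePhi_negI_sum (s := s) (by linarith) ha0 1 (by norm_num; linarith) (by
    simp only [Nat.cast_one, mul_one]; linarith)
  rw [Finset.Icc_self, Finset.sum_singleton] at h3
  rw [Finset.Icc_self, Finset.sum_singleton, Finset.sum_singleton] at h2
  simp only [Nat.cast_one] at h2 h3
  set P := afePhi s (2 * π * Complex.I * ((1:ℝ):ℂ)) (-Complex.I * a)
  set Q := afePhi s (2 * π * Complex.I * ((1:ℝ):ℂ)) a
  have h4 : afeFull s 1 = (afeFull s 1 - Q) - (P - Q) + P := by ring
  have h5 : ‖afeFull s 1‖ ≤ ‖afeFull s 1 - Q‖ + ‖P - Q‖ + ‖P‖ := by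
    conv_lhs => rw [h4]
    exact (norm_add_le _ _).trans (by gcongr; exact norm_sub_le _ _)
  have h6 : a * a ^ (-s.re) / √s.im ≤ (2 * π) ^ M * s.im ^ ((1:ℝ)/2 - s.re) := by
    have e1 : a * a ^ (-s.re) = a ^ (1 - s.re) := by
      rw [sub_eq_add_neg, Real.rpow_add ha0, Real.rpow_one]
    have e2 : a ^ (1 - s.re) = s.im ^ (1 - s.re) * (2 * π) ^ (s.re - 1) := by
      rw [ha, Real.div_rpow ht0.le (by positivity), div_eq_mul_inv, ← Real.rpow_neg (by positivity)]
      congr 2; ring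
    have e3 : s.im ^ (1 - s.re) = s.im ^ ((1:ℝ)/2 - s.re) * √s.im := by
      rw [Real.sqrt_eq_rpow, ← Real.rpow_add ht0]; congr 1; ring
    have e4 : (2 * π) ^ (s.re - 1) ≤ (2 * π) ^ M :=
      Real.rpow_le_rpow_of_exponent_le (by linarith) (by linarith [le_abs_self s.re])
    have h8 : 0 < √s.im := Real.sqrt_pos.mpr ht0
    rw [e1, e2, e3]
    calc _ = (2 * π) ^ (s.re - 1) * s.im ^ ((1:ℝ)/2 - s.re) := by field_simp
      _ ≤ _ := by gcongr
  calc _ ≤ _ := h5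
    _ ≤ (8 * (4 * M + 1) ^ M * Real.exp 3 + 8 * 2 ^ M * Real.exp 5 + 15) * (a * a ^ (-s.re) / √s.im) := by linarith
    _ ≤ (8 * (4 * M + 1) ^ M * Real.exp 3 + 8 * 2 ^ M * Real.exp 5 + 15) *
        ((2 * π) ^ M * s.im ^ ((1:ℝ)/2 - s.re)) := by gcongr
    _ = _ := by ring

def afeLow (s : ℂ) (k : ℝ) : ℂ :=
  (-Complex.I) ^ (1 - s) * ((1 / ((2 * π * k : ℝ) : ℂ)) ^ (1 - s) * Complex.Gamma (1 - s))

lemma afeFull_eq (s : ℂ) (k : ℝ) : afeFull s k =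
    Complex.I ^ (1 - s) * ((1 / ((2 * π * k : ℝ) : ℂ)) ^ (1 - s) * Complex.Gamma (1 - s)) := by
  unfold afeFull
  rw [sub_eq_add_neg 1 s, Complex.cpow_add _ _ Complex.I_ne_zero, Complex.cpow_one]

lemma afe_chi_Gammaℝ (s : ℂ) : chi s = Complex.Gammaℝ (1 - s) / Complex.Gammaℝ s := by
  unfold chi
  rw [Complex.Gammaℝ_def, Complex.Gammaℝ_def]
  have hpi : (π:ℂ) ≠ 0 := by exact_mod_cast Real.pi_ne_zero
  have h1 : s - 1 / 2 = -(1 - s) / 2 - (-s / 2) := by ring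
  rw [h1, Complex.cpow_sub _ _ hpi]
  ring

lemma afe_kpow (s : ℂ) {k : ℝ} (hk : 0 < k) : (1 / ((2 * π * k : ℝ) : ℂ)) ^ (1 - s) =
    (2 * π : ℂ) ^ (-(1 - s)) * (k:ℂ) ^ (-(1 - s)) := by
  have h2 : (0:ℝ) < 2 * π := by positivity
  rw [one_div, Complex.inv_cpow _ _ (by
    rw [Complex.arg_ofReal_of_nonneg (by positivity)]; exact Real.pi_pos.ne)]
  rw [← Complex.cpow_neg, Complex.ofReal_mul, Complex.mul_cpow_ofReal_nonneg h2.le hk.le]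
  push_cast; rfl

lemma afe_chi {s : ℂ} (hs : s.im ≠ 0) {k : ℝ} (hk : 0 < k) :
    afeFull s k + afeLow s k = chi s * (k:ℂ) ^ (-(1 - s)) := by
  have h := Complex.Gammaℝ_div_Gammaℝ_one_sub (s := 1 - s) (by
    intro n h
    have := congrArg Complex.im h
    simp at this
    exact hs this)
  rw [sub_sub_cancel] at h
  rw [afe_chi_Gammaℝ, h, afeFull_eq, afeLow, afe_kpow s hk, Complex.Gammaℂ_def]
  have hI : Complex.I ^ (1 - s) + (-Complex.I) ^ (1 - s) = 2 * Complex.cos (π * (1 - s) / 2) := by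
    rw [Complex.cpow_def_of_ne_zero Complex.I_ne_zero,
      Complex.cpow_def_of_ne_zero (neg_ne_zero.mpr Complex.I_ne_zero), Complex.log_I, Complex.log_neg_I,
      Complex.two_cos]
    congr 2 <;> ring
  rw [← add_mul, hI]
  ring

lemma afeFull_norm {s : ℂ} {k : ℝ} (hk : 0 < k) :
    ‖afeFull s k‖ = k ^ (s.re - 1) * ‖afeFull s 1‖ := by
  rw [afeFull_eq, afeFull_eq, afe_kpow s hk, afe_kpow s one_pos]
  simp only [norm_mul, Complex.ofReal_one, Complex.one_cpow, norm_one]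
  rw [Complex.norm_cpow_eq_rpow_re_of_pos hk]
  have : (-(1 - s)).re = s.re - 1 := by simp
  rw [this]; ring

lemma afeLow_norm (s : ℂ) (k : ℝ) : ‖afeLow s k‖ = Real.exp (-(π * s.im)) * ‖afeFull s k‖ := by
  rw [afeFull_eq, afeLow]
  have e : 1 - s = -(s - 1) := by ring
  simp only [norm_mul]
  have h1 : ‖(-Complex.I) ^ (1 - s)‖ = Real.exp (-(π * s.im)) * ‖Complex.I ^ (1 - s)‖ := by
    rw [e, afe_norm_cpow _ Complex.I_ne_zero, afe_norm_cpow _ (neg_ne_zero.mpr Complex.I_ne_zero),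
      Complex.arg_I, Complex.arg_neg_I]
    simp only [norm_neg, Complex.norm_I, Real.one_rpow, one_mul]
    rw [← Real.exp_add]; congr 1; simp; ring
  rw [h1]; ring

lemma afe_chi_norm {s : ℂ} (hs : 0 < s.im) : ‖chi s‖ ≤ 2 * ‖afeFull s 1‖ := by
  have h := afe_chi hs.ne' one_pos
  rw [Complex.ofReal_one, Complex.one_cpow, mul_one] at h
  rw [← h]
  refine (norm_add_le _ _).trans ?_
  rw [afeLow_norm]
  have : Real.exp (-(π * s.im)) ≤ 1 := Real.exp_le_one_iff.mpr (by have := Real.pi_pos; nlinarith)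
  nlinarith [norm_nonneg (afeFull s 1)]

def afeE (z : ℂ) : ℂ := Complex.exp (2 * π * Complex.I * z)

def afeg (s : ℂ) (n : ℕ) (z : ℂ) : ℂ := dslope (fun z : ℂ => z ^ (-s)) n z / dslope afeE n z

lemma afeE_hasDerivAt (z : ℂ) : HasDerivAt afeE (afeE z * (2 * π * Complex.I)) z := by
  have := ((hasDerivAt_id z).const_mul (2 * π * Complex.I)).cexp
  exact this.congr_deriv (by simp [afeE])

lemma afeE_nat (n : ℕ) : afeE n = 1 := by
  rw [afeE, Complex.exp_eq_one_iff]; exact ⟨n, by push_cast; ring⟩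

lemma afeE_ne_one {n : ℕ} {z : ℂ} (h : |z.re - n| ≤ 1 / 2) (hz : z ≠ n) : afeE z ≠ 1 := by
  intro h1
  rw [afeE, Complex.exp_eq_one_iff] at h1
  obtain ⟨j, hj⟩ := h1
  have h2 : z = j := by
    have : (2 * π * Complex.I : ℂ) ≠ 0 := Complex.two_pi_I_ne_zero
    apply mul_left_cancel₀ this; rw [hj]; ring
  rw [h2] at h hz
  simp only [Complex.intCast_re] at h
  have h3 : |((j - n : ℤ) : ℝ)| < 1 := by push_cast; linarith
  have h4 : |(j - n : ℤ)| < 1 := by exact_mod_cast h3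
  rw [Int.abs_lt_one_iff] at h4
  apply hz
  have : j = n := by omega
  rw [this]; simp

lemma afeg_dslope_ne {n : ℕ} {z : ℂ} (h : |z.re - n| ≤ 1 / 2) : dslope afeE n z ≠ 0 := by
  by_cases hz : z = n
  · rw [hz, dslope_same, (afeE_hasDerivAt _).deriv, afeE_nat, one_mul]
    exact Complex.two_pi_I_ne_zero
  · rw [dslope_of_ne _ hz, slope_def_field, afeE_nat]
    exact div_ne_zero (sub_ne_zero.mpr (afeE_ne_one h hz)) (sub_ne_zero.mpr hz)

lemma afeg_eq {s : ℂ} {n : ℕ} {z : ℂ} (hz : z ≠ n) :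
    afeg s n z = (z ^ (-s) - (n:ℂ) ^ (-s)) / (afeE z - 1) := by
  have h : z - n ≠ 0 := sub_ne_zero.mpr hz
  rw [afeg, dslope_of_ne _ hz, dslope_of_ne _ hz, slope_def_field, slope_def_field, afeE_nat]
  rw [div_div_div_cancel_right₀ h]

lemma afe_f_diff (s : ℂ) {z : ℂ} (hz : 0 < z.re) : DifferentiableAt ℂ (fun z : ℂ => z ^ (-s)) z :=
  (differentiableAt_id).cpow_const (Or.inl hz)

lemma afeg_diff (s : ℂ) {n : ℕ} (hn : 1 ≤ n) :
    DifferentiableOn ℂ (afeg s n) {z : ℂ | |z.re - n| ≤ 1 / 2} := by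
  have hn' : (1:ℝ) ≤ n := by exact_mod_cast hn
  have hU : IsOpen {z : ℂ | 0 < z.re} := isOpen_lt continuous_const Complex.continuous_re
  have h1 : DifferentiableOn ℂ (dslope (fun z : ℂ => z ^ (-s)) n) {z : ℂ | 0 < z.re} := by
    rw [Complex.differentiableOn_dslope (hU.mem_nhds (by simp; linarith))]
    intro z hz
    exact (afe_f_diff s hz).differentiableWithinAt
  have h2 : DifferentiableOn ℂ (dslope afeE n) Set.univ := by
    rw [Complex.differentiableOn_dslope Filter.univ_mem]
    intro z _
    exact (afeE_hasDerivAt z).differentiableAt.differentiableWithinAt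
  refine DifferentiableOn.div (h1.mono ?_) (h2.mono (Set.subset_univ _)) (fun z hz => afeg_dslope_ne hz)
  intro z hz
  simp only [Set.mem_ofPred_eq, abs_le] at hz ⊢
  linarith

lemma afe_rect (s : ℂ) {n : ℕ} (hn : 1 ≤ n) (H : ℝ) (hH : 0 ≤ H) :
    (∫ x in (n - 1/2 : ℝ)..(n + 1/2 : ℝ), afeg s n (x + (-H : ℝ) * Complex.I)) -
    (∫ x in (n - 1/2 : ℝ)..(n + 1/2 : ℝ), afeg s n (x + (H : ℝ) * Complex.I)) +
    Complex.I * (∫ y in (-H)..H, afeg s n ((n + 1/2 : ℝ) + y * Complex.I)) -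
    Complex.I * (∫ y in (-H)..H, afeg s n ((n - 1/2 : ℝ) + y * Complex.I)) = 0 := by
  have := Complex.integral_boundary_rect_eq_zero_of_differentiableOn (afeg s n)
    (((n - 1/2 : ℝ):ℂ) + (-H : ℝ) * Complex.I) (((n + 1/2 : ℝ):ℂ) + (H : ℝ) * Complex.I) ?_
  · simpa using this
  · apply (afeg_diff s hn).mono
    intro z hz
    rw [Complex.mem_reProdIm] at hz
    have h1 := hz.1
    simp only [Complex.add_re, Complex.ofReal_re, Complex.mul_re, Complex.I_re, Complex.ofReal_im, Complex.I_im] at h1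
    rw [Set.uIcc_of_le (by linarith)] at h1
    have h2 := h1.1
    have h3 := h1.2
    simp only [Set.mem_ofPred_eq, abs_le]
    constructor <;> linarith

lemma afeE_norm (z : ℂ) : ‖afeE z‖ = Real.exp (-(2 * π * z.im)) := by
  rw [afeE, Complex.norm_exp]; congr 1; simp

lemma afeE_half (n : ℕ) (y : ℝ) (b : ℝ) (hb : b = n + 1/2 ∨ b = n - 1/2) :
    afeE (b + y * Complex.I) = -(Real.exp (-(2 * π * y)) : ℂ) := by
  have h0 : Complex.exp (2 * π * Complex.I * b) = -1 := by
    rcases hb with rfl | rfl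
    · have : 2 * π * Complex.I * ((n + 1/2 : ℝ):ℂ) = π * Complex.I + n * (2 * π * Complex.I) := by push_cast; ring
      rw [this, Complex.exp_add, Complex.exp_pi_mul_I, Complex.exp_nat_mul_two_pi_mul_I]; simp
    · have : 2 * π * Complex.I * ((n - 1/2 : ℝ):ℂ) = - (π * Complex.I) + n * (2 * π * Complex.I) := by push_cast; ring
      rw [this, Complex.exp_add, Complex.exp_neg, Complex.exp_pi_mul_I, Complex.exp_nat_mul_two_pi_mul_I]; norm_num
  rw [afeE]
  have : 2 * π * Complex.I * (b + y * Complex.I) = 2 * π * Complex.I * b + ((-(2 * π * y) : ℝ) : ℂ) := by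
    push_cast; linear_combination (2 * π * y) * Complex.I_sq
  rw [this, Complex.exp_add, h0, Complex.ofReal_exp]; ring

lemma afe_f_bound {s : ℂ} (hσ : 0 ≤ s.re) (ht : 0 ≤ s.im) {b : ℝ} (hb : 0 < b) {z : ℂ} (hz : b ≤ z.re) :
    ‖z ^ (-s)‖ ≤ b ^ (-s.re) * Real.exp (s.im * (π / 2)) := by
  have hz0 : z ≠ 0 := by rintro rfl; simp at hz; linarith
  rw [afe_norm_cpow s hz0]
  have h1 : b ≤ ‖z‖ := hz.trans (Complex.re_le_norm z)
  have h2 : ‖z‖ ^ (-s.re) ≤ b ^ (-s.re) := Real.rpow_le_rpow_of_nonpos hb h1 (by linarith)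
  have h3 : z.arg ≤ π / 2 := Complex.arg_le_pi_div_two_iff.mpr (Or.inl (by linarith))
  gcongr

def afeK (y : ℝ) : ℝ := 1 / (1 + Real.exp (2 * π * y))

lemma afeK_den (y : ℝ) : 0 < 1 + Real.exp (2 * π * y) := by positivity

lemma afeK_cont : Continuous afeK := by
  unfold afeK
  exact continuous_const.div (by fun_prop) (fun y => (afeK_den y).ne')

lemma afeK_neg (y : ℝ) : afeK (-y) = 1 - afeK y := by
  unfold afeK
  have h1 : Real.exp (2 * π * -y) = (Real.exp (2 * π * y))⁻¹ := by rw [← Real.exp_neg]; congr 1; ring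
  rw [h1]
  have := Real.exp_pos (2 * π * y)
  field_simp
  ring

lemma afe_v_cont (s : ℂ) {b : ℝ} (hb : 0 < b) : Continuous (fun y : ℝ => ((b:ℂ) + y * Complex.I) ^ (-s)) := by
  refine Continuous.cpow (by fun_prop) continuous_const (fun y => Or.inl ?_)
  simpa using hb

lemma afe_v_cont' (s : ℂ) {b : ℝ} (hb : 0 < b) : Continuous (fun y : ℝ => ((b:ℂ) - y * Complex.I) ^ (-s)) := by
  refine Continuous.cpow (by fun_prop) continuous_const (fun y => Or.inl ?_)
  simpa using hb

def afeD (s : ℂ) (b y : ℝ) : ℂ := ((b:ℂ) + y * Complex.I) ^ (-s) - ((b:ℂ) - y * Complex.I) ^ (-s)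

def afeF (s z : ℂ) : ℂ := z ^ (1 - s) / (1 - s)

lemma afeF_hasDerivAt {s z : ℂ} (hs : s ≠ 1) (hz : 0 < z.re) : HasDerivAt (afeF s) (z ^ (-s)) z := by
  have h1 : HasDerivAt (fun z : ℂ => z ^ (1 - s)) ((1 - s) * z ^ (1 - s - 1) * 1) z :=
    (hasDerivAt_id z).cpow_const (Or.inl hz)
  have h2 := h1.div_const (1 - s)
  refine h2.congr_deriv ?_
  have : 1 - s ≠ 0 := sub_ne_zero.mpr (Ne.symm hs)
  field_simp
  congr 1; ring

lemma afe_vert_int {s : ℂ} (hs : s ≠ 1) {b : ℝ} (hb : 0 < b) (H : ℝ) :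
    Complex.I * ∫ y in (0:ℝ)..H, ((b:ℂ) + y * Complex.I) ^ (-s) = afeF s (b + H * Complex.I) - afeF s b := by
  have h1 : ∀ y ∈ Set.uIcc 0 H, HasDerivAt (fun y : ℝ => afeF s (b + y * Complex.I))
      (((b:ℂ) + y * Complex.I) ^ (-s) * Complex.I) y := by
    intro y _
    have h2 : HasDerivAt (fun y : ℝ => (b:ℂ) + y * Complex.I) (((1:ℝ):ℂ) * Complex.I) y :=
      ((hasDerivAt_id y).ofReal_comp.mul_const _).const_add _
    have h3 := (afeF_hasDerivAt hs (z := (b:ℂ) + y * Complex.I) (by simpa using hb)).comp y h2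
    exact h3.congr_deriv (by simp)
  have h4 := intervalIntegral.integral_eq_sub_of_hasDerivAt h1
    (((afe_v_cont s hb).mul continuous_const).intervalIntegrable _ _)
  rw [intervalIntegral.integral_mul_const] at h4
  rw [mul_comm, h4]; simp

lemma afe_horiz_int {s : ℂ} (hs : s ≠ 1) {b c : ℝ} (hb : 0 < b) (hbc : b ≤ c) (H : ℝ) :
    ∫ x in b..c, ((x:ℂ) + H * Complex.I) ^ (-s) = afeF s (c + H * Complex.I) - afeF s (b + H * Complex.I) := by
  have hpos : ∀ x ∈ Set.uIcc b c, 0 < ((x:ℂ) + H * Complex.I).re := by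
    intro x hx
    rw [Set.uIcc_of_le hbc] at hx
    have := hx.1
    simp; linarith
  have h1 : ∀ x ∈ Set.uIcc b c, HasDerivAt (fun x : ℝ => afeF s (x + H * Complex.I))
      (((x:ℂ) + H * Complex.I) ^ (-s)) x := by
    intro x hx
    have h2 : HasDerivAt (fun x : ℝ => (x:ℂ) + H * Complex.I) (((1:ℝ):ℂ)) x :=
      ((hasDerivAt_id x).ofReal_comp).add_const _
    have h3 := (afeF_hasDerivAt hs (hpos x hx)).comp x h2
    exact h3.congr_deriv (by simp)
  refine intervalIntegral.integral_eq_sub_of_hasDerivAt h1 ?_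
  apply ContinuousOn.intervalIntegrable
  intro x hx
  have : ContinuousAt (fun x : ℝ => ((x:ℂ) + H * Complex.I) ^ (-s)) x :=
    ContinuousAt.cpow (by fun_prop) continuousAt_const (Or.inl (hpos x hx))
  exact this.continuousWithinAt

lemma afe_vert {s : ℂ} (hs : s ≠ 1) {n : ℕ} {b : ℝ} (hb0 : 0 < b) (hb : b = n + 1/2 ∨ b = n - 1/2) (H : ℝ) :
    Complex.I * (∫ y in (-H)..H, afeg s n (b + y * Complex.I)) =
      -(afeF s (b + H * Complex.I) - afeF s b) + Complex.I * (∫ y in (0:ℝ)..H, afeD s b y * (afeK y : ℂ))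
      + Complex.I * (∫ y in (-H)..H, (n:ℂ) ^ (-s) * (afeK (-y) : ℂ)) := by
  set v : ℝ → ℂ := fun y => ((b:ℂ) + y * Complex.I) ^ (-s) with hv
  have hvc : Continuous v := afe_v_cont s hb0
  have hKc : Continuous (fun y : ℝ => (afeK y : ℂ)) := Complex.continuous_ofReal.comp afeK_cont
  have hKn : Continuous (fun y : ℝ => (afeK (-y) : ℂ)) := hKc.comp continuous_neg
  have c1 : Continuous (fun y : ℝ => (n:ℂ) ^ (-s) * (afeK (-y) : ℂ)) := continuous_const.mul hKn
  have c2 : Continuous (fun y : ℝ => v y * (afeK (-y) : ℂ)) := hvc.mul hKn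
  have c3 : Continuous (fun y : ℝ => v y * (afeK y : ℂ)) := hvc.mul hKc
  have c4 : Continuous (fun y : ℝ => v (-y) * (afeK y : ℂ)) := (hvc.comp continuous_neg).mul hKc
  have e1 : ∀ y : ℝ, afeg s n (b + y * Complex.I) = (n:ℂ) ^ (-s) * (afeK (-y) : ℂ) - v y * (afeK (-y) : ℂ) := by
    intro y
    have hne : (b:ℂ) + y * Complex.I ≠ n := by
      intro h
      have h1 := congrArg Complex.re h
      simp at h1
      rcases hb with h2 | h2 <;> linarith
    rw [afeg_eq hne, afeE_half n y b hb]
    have h2 : (afeK (-y) : ℂ) = 1 / (1 + (Real.exp (-(2 * π * y)) : ℂ)) := by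
      unfold afeK; push_cast; congr 3; ring_nf
    have h3 : (1 + (Real.exp (-(2 * π * y)) : ℂ)) ≠ 0 := by
      have : 0 < 1 + Real.exp (-(2 * π * y)) := by positivity
      exact_mod_cast this.ne'
    have h4 : -(Real.exp (-(2 * π * y)) : ℂ) - 1 = -(1 + (Real.exp (-(2 * π * y)) : ℂ)) := by ring
    rw [h2, h4, hv]
    field_simp
    ring
  simp_rw [e1]
  rw [intervalIntegral.integral_sub (c1.intervalIntegrable _ _)
    (c2.intervalIntegrable _ _)]
  have e2 : ∫ y in (-H)..H, v y * (afeK (-y) : ℂ) = (∫ y in (0:ℝ)..H, v (-y) * (afeK y : ℂ)) +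
      ∫ y in (0:ℝ)..H, v y * (afeK (-y) : ℂ) := by
    rw [← intervalIntegral.integral_add_adjacent_intervals (b := 0) (c2.intervalIntegrable _ _)
      (c2.intervalIntegrable _ _)]
    congr 1
    have := intervalIntegral.integral_comp_neg (a := 0) (b := H) (fun y : ℝ => v y * (afeK (-y) : ℂ))
    simp only [neg_neg, neg_zero] at this
    exact this.symm
  have e3 : ∫ y in (0:ℝ)..H, v y * (afeK (-y) : ℂ) = (∫ y in (0:ℝ)..H, v y) - ∫ y in (0:ℝ)..H, v y * (afeK y : ℂ) := by
    rw [← intervalIntegral.integral_sub (hvc.intervalIntegrable _ _) (c3.intervalIntegrable _ _)]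
    congr 1; ext y; rw [afeK_neg]; push_cast; ring
  have e4 : ∫ y in (0:ℝ)..H, afeD s b y * (afeK y : ℂ) = (∫ y in (0:ℝ)..H, v y * (afeK y : ℂ)) -
      ∫ y in (0:ℝ)..H, v (-y) * (afeK y : ℂ) := by
    rw [← intervalIntegral.integral_sub (c3.intervalIntegrable _ _)
      (c4.intervalIntegrable _ _)]
    congr 1; ext y; simp only [afeD, hv]; push_cast; ring_nf
  rw [e2, e3, e4, ← afe_vert_int hs hb0 H]
  ring

lemma afe_diff_bound {s : ℂ} (hσ : 0 ≤ s.re) (ht : 0 ≤ s.im) {n : ℕ} (hn : 1 ≤ n) {z : ℂ} (hz : 1/2 ≤ z.re) :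
    ‖z ^ (-s) - (n:ℂ) ^ (-s)‖ ≤ 2 * ((1/2) ^ (-s.re) * Real.exp (s.im * (π / 2))) := by
  have hn' : (1:ℝ) ≤ n := by exact_mod_cast hn
  have h1 := afe_f_bound hσ ht (by norm_num) hz
  have h2 := afe_f_bound hσ ht (by norm_num) (z := (n:ℂ)) (b := 1/2) (by simp; linarith)
  exact (norm_sub_le _ _).trans (by linarith)

lemma afe_exp_ge {H : ℝ} (hH : 0 < H) : H + 1 ≤ Real.exp (2 * π * H) := by
  have h := Real.add_one_le_exp (2 * π * H)
  have := Real.pi_gt_three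
  nlinarith

lemma afe_bottom {s : ℂ} (hσ : 0 ≤ s.re) (ht : 0 ≤ s.im) {n : ℕ} (hn : 1 ≤ n) {H : ℝ} (hH : 0 < H) :
    ‖∫ x in (n - 1/2 : ℝ)..(n + 1/2 : ℝ), afeg s n (x + (-H : ℝ) * Complex.I)‖ ≤
      2 * ((1/2) ^ (-s.re) * Real.exp (s.im * (π / 2))) / H := by
  have hn' : (1:ℝ) ≤ n := by exact_mod_cast hn
  have h := intervalIntegral.norm_integral_le_of_norm_le_const (a := (n - 1/2 : ℝ)) (b := (n + 1/2 : ℝ))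
    (f := fun x : ℝ => afeg s n (x + (-H : ℝ) * Complex.I))
    (C := 2 * ((1/2) ^ (-s.re) * Real.exp (s.im * (π / 2))) / H) ?_
  · refine h.trans (le_of_eq ?_)
    have : (n + 1/2 : ℝ) - (n - 1/2 : ℝ) = 1 := by ring
    rw [this]; simp
  · intro x hx
    rw [Set.uIoc_of_le (by linarith)] at hx
    set z : ℂ := x + (-H : ℝ) * Complex.I with hz
    have hre : z.re = x := by simp [hz]
    have him : z.im = -H := by simp [hz]
    have hne : z ≠ n := by
      intro h; rw [h] at him; simp at him; linarith
    rw [afeg_eq hne, norm_div]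
    have h1 := afe_diff_bound hσ ht hn (z := z) (by rw [hre]; linarith [hx.1])
    have h2 : H ≤ ‖afeE z - 1‖ := by
      have h3 := norm_sub_norm_le (afeE z) 1
      rw [afeE_norm, him, norm_one] at h3
      have := afe_exp_ge hH
      have h5 : -(2 * π * -H) = 2 * π * H := by ring
      rw [h5] at h3
      linarith
    gcongr

lemma afe_top {s : ℂ} (hs : s ≠ 1) (hσ : 0 ≤ s.re) (ht : 0 ≤ s.im) {n : ℕ} (hn : 1 ≤ n) {H : ℝ} (hH : 0 < H) :
    ‖(∫ x in (n - 1/2 : ℝ)..(n + 1/2 : ℝ), afeg s n (x + (H : ℝ) * Complex.I)) +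
      (afeF s ((n + 1/2 : ℝ) + H * Complex.I) - afeF s ((n - 1/2 : ℝ) + H * Complex.I)) - (n:ℂ) ^ (-s)‖ ≤
      2 * ((1/2) ^ (-s.re) * Real.exp (s.im * (π / 2))) / H := by
  have hn' : (1:ℝ) ≤ n := by exact_mod_cast hn
  have hle : (n - 1/2 : ℝ) ≤ n + 1/2 := by linarith
  rw [← afe_horiz_int hs (by linarith) hle H]
  have hlen : (n + 1/2 : ℝ) - (n - 1/2 : ℝ) = 1 := by ring
  have i1 : IntervalIntegrable (fun x : ℝ => afeg s n (x + (H : ℝ) * Complex.I)) volume (n - 1/2 : ℝ) (n + 1/2 : ℝ) := by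
    apply ContinuousOn.intervalIntegrable
    rw [Set.uIcc_of_le hle]
    refine (afeg_diff s hn).continuousOn.comp (by fun_prop) ?_
    intro x hx
    simp only [Set.mem_ofPred_eq]
    have h1 := hx.1; have h2 := hx.2
    simp [abs_le]; constructor <;> linarith
  have i2 : IntervalIntegrable (fun x : ℝ => ((x:ℂ) + H * Complex.I) ^ (-s)) volume (n - 1/2 : ℝ) (n + 1/2 : ℝ) := by
    apply ContinuousOn.intervalIntegrable
    rw [Set.uIcc_of_le hle]
    intro x hx
    have h1 := hx.1
    have : ContinuousAt (fun x : ℝ => ((x:ℂ) + H * Complex.I) ^ (-s)) x :=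
      ContinuousAt.cpow (by fun_prop) continuousAt_const (Or.inl (by simp; linarith))
    exact this.continuousWithinAt
  have i3 : (n:ℂ) ^ (-s) = ∫ x in (n - 1/2 : ℝ)..(n + 1/2 : ℝ), (n:ℂ) ^ (-s) := by
    rw [intervalIntegral.integral_const, hlen, one_smul]
  rw [i3, ← intervalIntegral.integral_add i1 i2, ← intervalIntegral.integral_sub (i1.add i2) intervalIntegrable_const]
  have h := intervalIntegral.norm_integral_le_of_norm_le_const (a := (n - 1/2 : ℝ)) (b := (n + 1/2 : ℝ))
    (f := fun x : ℝ => afeg s n (x + (H : ℝ) * Complex.I) + ((x:ℂ) + H * Complex.I) ^ (-s) - (n:ℂ) ^ (-s))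
    (C := 2 * ((1/2) ^ (-s.re) * Real.exp (s.im * (π / 2))) / H) ?_
  · refine h.trans (le_of_eq ?_)
    rw [hlen]; simp
  · intro x hx
    rw [Set.uIoc_of_le (by linarith)] at hx
    set z : ℂ := x + (H : ℝ) * Complex.I with hz
    have hre : z.re = x := by simp [hz]
    have him : z.im = H := by simp [hz]
    have hne : z ≠ n := by
      intro h; rw [h] at him; simp at him; linarith
    have hE := afeE_norm z
    rw [him, Real.exp_neg] at hE
    have hexp := afe_exp_ge hH
    set r := Real.exp (2 * π * H)
    have h3 : 1 - r⁻¹ ≤ ‖afeE z - 1‖ := by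
      have h3 := norm_sub_norm_le 1 (afeE z)
      rw [norm_sub_rev, hE, norm_one] at h3
      exact h3
    have hr1 : 1 < r := by linarith
    have hr2 : r⁻¹ < 1 := inv_lt_one_of_one_lt₀ hr1
    have hEne : afeE z - 1 ≠ 0 := by
      intro h; rw [h, norm_zero] at h3; linarith
    have h4 : afeg s n z + z ^ (-s) - (n:ℂ) ^ (-s) = (z ^ (-s) - (n:ℂ) ^ (-s)) * (afeE z / (afeE z - 1)) := by
      rw [afeg_eq hne]; field_simp; ring
    rw [h4, norm_mul, norm_div, hE]
    have h1 := afe_diff_bound hσ ht hn (z := z) (by rw [hre]; linarith [hx.1])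
    have h5 : r⁻¹ / ‖afeE z - 1‖ ≤ 1 / H := by
      rw [div_le_div_iff₀ (by linarith) hH]
      have : r⁻¹ * H ≤ 1 - r⁻¹ := by
        have : r⁻¹ * (H + 1) ≤ r⁻¹ * r := by gcongr
        rw [inv_mul_cancel₀ (by linarith)] at this
        linarith
      linarith
    calc _ ≤ 2 * ((1/2) ^ (-s.re) * Real.exp (s.im * (π / 2))) * (1 / H) := by gcongr
      _ = _ := by ring

lemma afe_step_fin {s : ℂ} (hs : s ≠ 1) (hσ : 0 ≤ s.re) (ht : 0 ≤ s.im) {n : ℕ} (hn : 1 ≤ n) {H : ℝ} (hH : 0 < H) :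
    ‖(n:ℂ) ^ (-s) - ((afeF s (n + 1/2 : ℝ) + Complex.I * ∫ y in (0:ℝ)..H, afeD s (n + 1/2) y * (afeK y : ℂ)) -
      (afeF s (n - 1/2 : ℝ) + Complex.I * ∫ y in (0:ℝ)..H, afeD s (n - 1/2) y * (afeK y : ℂ)))‖ ≤
      4 * ((1/2) ^ (-s.re) * Real.exp (s.im * (π / 2))) / H := by
  have hn' : (1:ℝ) ≤ n := by exact_mod_cast hn
  have h0 := afe_rect s hn H hH.le
  have h1 := afe_bottom hσ ht hn hH
  have h2 := afe_top hs hσ ht hn hH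
  rw [afe_vert hs (by linarith) (Or.inl rfl) H, afe_vert hs (by linarith) (Or.inr rfl) H] at h0
  set Bo := ∫ x in (n - 1/2 : ℝ)..(n + 1/2 : ℝ), afeg s n (x + (-H : ℝ) * Complex.I)
  set To := ∫ x in (n - 1/2 : ℝ)..(n + 1/2 : ℝ), afeg s n (x + (H : ℝ) * Complex.I)
  set To' := To + (afeF s ((n + 1/2 : ℝ) + H * Complex.I) - afeF s ((n - 1/2 : ℝ) + H * Complex.I)) - (n:ℂ) ^ (-s) with hT
  have h3 : (n:ℂ) ^ (-s) - ((afeF s (n + 1/2 : ℝ) + Complex.I * ∫ y in (0:ℝ)..H, afeD s (n + 1/2) y * (afeK y : ℂ)) -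
      (afeF s (n - 1/2 : ℝ) + Complex.I * ∫ y in (0:ℝ)..H, afeD s (n - 1/2) y * (afeK y : ℂ))) = Bo - To' := by
    rw [hT]; linear_combination -h0
  rw [h3]
  refine (norm_sub_le _ _).trans ((add_le_add h1 h2).trans (le_of_eq ?_))
  ring

lemma afe_norm_log (z : ℂ) : ‖Complex.log z‖ ≤ |Real.log ‖z‖| + π := by
  have h := Complex.norm_le_abs_re_add_abs_im (Complex.log z)
  rw [Complex.log_re, Complex.log_im] at h
  linarith [Complex.abs_arg_le_pi z]

lemma afe_growth {a M T : ℝ} (ha : 1 ≤ a) (hM : 0 ≤ M) : ∃ C : ℝ, 0 ≤ C ∧ ∀ (s z : ℂ) (y : ℝ), |s.re| ≤ M → |s.im| ≤ T →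
    z.re = a → |z.im| ≤ y → ‖z ^ (-s)‖ ≤ C * Real.exp y ∧ ‖z ^ (-s)‖ * ‖Complex.log z‖ ≤ C * Real.exp y := by
  refine ⟨(a + 4 + (M + 1)) ^ (M + 1) * Real.exp (T * π), by positivity, ?_⟩
  intro s z y hσ ht hre him
  have hy : 0 ≤ y := (abs_nonneg _).trans him
  have hz1 : 1 ≤ ‖z‖ := by
    have := Complex.re_le_norm z; rw [hre] at this; linarith
  have hz2 : ‖z‖ ≤ a + y := by
    have := Complex.norm_le_abs_re_add_abs_im z
    rw [hre, abs_of_pos (by linarith)] at this; linarith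
  have hz0 : z ≠ 0 := by rintro rfl; simp at hz1; linarith
  set c := a + 4 + (M + 1) with hc
  have hc0 : 0 < c := by positivity
  have h1 : (y + c) ^ (M + 1) ≤ c ^ (M + 1) * Real.exp y := by
    have h2 : y + c ≤ c * Real.exp (y / c) := by
      have h3 := Real.add_one_le_exp (y / c)
      have h4 : c * (y / c + 1) = y + c := by field_simp
      rw [← h4]; gcongr
    have h3 := Real.rpow_le_rpow (z := M + 1) (by positivity) h2 (by linarith)
    rw [Real.mul_rpow hc0.le (by positivity), ← Real.exp_mul] at h3
    refine h3.trans ?_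
    gcongr
    rw [div_mul_eq_mul_div, div_le_iff₀ hc0]
    gcongr; linarith
  have h2 : ‖z ^ (-s)‖ ≤ (y + c) ^ M * Real.exp (T * π) := by
    rw [afe_norm_cpow s hz0]
    have e1 : ‖z‖ ^ (-s.re) ≤ (y + c) ^ M :=
      (afe_rpow_le hz1 hσ).trans (Real.rpow_le_rpow (by linarith) (by linarith) hM)
    have e2 : s.im * z.arg ≤ T * π := by
      refine (le_abs_self _).trans ?_
      rw [abs_mul]
      exact mul_le_mul ht (Complex.abs_arg_le_pi z) (abs_nonneg _) ((abs_nonneg _).trans ht)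
    gcongr
  have h3 : ‖Complex.log z‖ ≤ y + c := by
    refine (afe_norm_log z).trans ?_
    rw [abs_of_nonneg (Real.log_nonneg hz1)]
    have := Real.log_le_sub_one_of_pos (show 0 < ‖z‖ by linarith)
    linarith [Real.pi_lt_four]
  have h4 : (y + c) ^ M * (y + c) = (y + c) ^ (M + 1) := by
    rw [Real.rpow_add (by positivity), Real.rpow_one]
  have h5 : ‖z ^ (-s)‖ * (y + c) ≤ c ^ (M + 1) * Real.exp (T * π) * Real.exp y := by
    calc _ ≤ (y + c) ^ M * Real.exp (T * π) * (y + c) := by gcongr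
      _ = (y + c) ^ (M + 1) * Real.exp (T * π) := by rw [← h4]; ring
      _ ≤ (c ^ (M + 1) * Real.exp y) * Real.exp (T * π) := by gcongr
      _ = _ := by ring
  constructor
  · refine le_trans ?_ h5
    nlinarith [norm_nonneg (z ^ (-s))]
  · refine le_trans ?_ h5
    gcongr

lemma afeK_le (y : ℝ) : afeK y ≤ Real.exp (-(2 * π * y)) := by
  unfold afeK
  rw [Real.exp_neg, one_div]
  have := Real.exp_pos (2 * π * y)
  gcongr; linarith

lemma afeK_nonneg (y : ℝ) : 0 ≤ afeK y := by unfold afeK; positivity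

lemma afeK_exp_le {y : ℝ} (hy : 0 ≤ y) : Real.exp y * afeK y ≤ Real.exp (-1 * y) := by
  calc _ ≤ Real.exp y * Real.exp (-(2 * π * y)) := by gcongr; exact afeK_le y
    _ = Real.exp (y + -(2 * π * y)) := (Real.exp_add _ _).symm
    _ ≤ _ := Real.exp_le_exp.mpr (by nlinarith [Real.pi_gt_three])

lemma afe_param {a : ℝ} (ha : 1 ≤ a) (w : ℝ → ℂ) (hw : Continuous w) (hre : ∀ y, (w y).re = a)
    (him : ∀ y, |(w y).im| ≤ |y|) (s : ℂ) :
    IntegrableOn (fun y : ℝ => (w y) ^ (-s) * (afeK y : ℂ)) (Set.Ioi 0) ∧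
    DifferentiableAt ℂ (fun s : ℂ => ∫ y in Set.Ioi (0:ℝ), (w y) ^ (-s) * (afeK y : ℂ)) s := by
  obtain ⟨C, hC0, hC⟩ := afe_growth (a := a) (M := |s.re| + 1) (T := |s.im| + 1) ha (by positivity)
  have hsl : ∀ y, w y ∈ Complex.slitPlane := fun y => Or.inl (by rw [hre]; linarith)
  have hKc : Continuous (fun y : ℝ => (afeK y : ℂ)) := Complex.continuous_ofReal.comp afeK_cont
  have hF : ∀ s : ℂ, Continuous (fun y : ℝ => (w y) ^ (-s) * (afeK y : ℂ)) := fun s =>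
    (hw.cpow continuous_const hsl).mul hKc
  have hF' : ∀ s : ℂ, Continuous (fun y : ℝ => (w y) ^ (-s) * Complex.log (w y) * (-1) * (afeK y : ℂ)) := fun s =>
    (((hw.cpow continuous_const hsl).mul (hw.clog hsl)).mul continuous_const).mul hKc
  have hbi : Integrable (fun y : ℝ => C * Real.exp (-1 * y)) (volume.restrict (Set.Ioi 0)) :=
    (exp_neg_integrableOn_Ioi 0 one_pos).const_mul C
  have hball : ∀ x ∈ Metric.ball s 1, |x.re| ≤ |s.re| + 1 ∧ |x.im| ≤ |s.im| + 1 := by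
    intro x hx
    rw [Metric.mem_ball, dist_eq_norm] at hx
    have h1 := Complex.abs_re_le_norm (x - s)
    have h2 := Complex.abs_im_le_norm (x - s)
    rw [Complex.sub_re] at h1
    rw [Complex.sub_im] at h2
    have h3 := abs_sub_abs_le_abs_sub x.re s.re
    have h4 := abs_sub_abs_le_abs_sub x.im s.im
    constructor <;> linarith
  have hmul : ∀ (A : ℂ) (y : ℝ), 0 < y → ‖A‖ ≤ C * Real.exp y → ‖A * (afeK y : ℂ)‖ ≤ C * Real.exp (-1 * y) := by
    intro A y hy hA
    rw [norm_mul, Complex.norm_real, Real.norm_of_nonneg (afeK_nonneg y)]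
    calc _ ≤ C * Real.exp y * afeK y := by gcongr; exact afeK_nonneg y
      _ = C * (Real.exp y * afeK y) := by ring
      _ ≤ _ := by gcongr; exact afeK_exp_le hy.le
  have hint : IntegrableOn (fun y : ℝ => (w y) ^ (-s) * (afeK y : ℂ)) (Set.Ioi 0) := by
    refine Integrable.mono' hbi (hF s).aestronglyMeasurable ?_
    filter_upwards [ae_restrict_mem measurableSet_Ioi] with y hy
    apply hmul _ _ hy
    exact (hC s (w y) y (by linarith) (by linarith) (hre y) ((him y).trans (abs_of_pos hy).le)).1
  refine ⟨hint, ?_⟩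
  have := (hasDerivAt_integral_of_dominated_loc_of_deriv_le (μ := volume.restrict (Set.Ioi (0:ℝ)))
    (F := fun s (y : ℝ) => (w y) ^ (-s) * (afeK y : ℂ)) (x₀ := s) (s := Metric.ball s 1)
    (F' := fun s (y : ℝ) => (w y) ^ (-s) * Complex.log (w y) * (-1) * (afeK y : ℂ))
    (bound := fun y : ℝ => C * Real.exp (-1 * y)) (Metric.ball_mem_nhds s one_pos)
    (Filter.Eventually.of_forall fun x => (hF x).aestronglyMeasurable) hint
    (hF' s).aestronglyMeasurable ?_ hbi ?_).2
  · exact this.differentiableAt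
  · filter_upwards [ae_restrict_mem measurableSet_Ioi] with y hy x hx
    apply hmul _ _ hy
    rw [norm_mul, norm_mul, norm_neg, norm_one, mul_one]
    exact (hC x (w y) y (hball x hx).1 (hball x hx).2 (hre y) ((him y).trans (abs_of_pos hy).le)).2
  · refine Filter.Eventually.of_forall fun y x _ => ?_
    have h1 : HasDerivAt (fun x : ℂ => -x) (-1) x := hasDerivAt_neg x
    have h2 := h1.const_cpow (c := w y) (Or.inl (Complex.slitPlane_ne_zero (hsl y)))
    exact h2.mul_const _

def afeUp (s : ℂ) (a : ℝ) : ℂ := ∫ y in Set.Ioi (0:ℝ), ((a:ℂ) + y * Complex.I) ^ (-s) * (afeK y : ℂ)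
def afeDn (s : ℂ) (a : ℝ) : ℂ := ∫ y in Set.Ioi (0:ℝ), ((a:ℂ) - y * Complex.I) ^ (-s) * (afeK y : ℂ)

lemma afeUp_param {a : ℝ} (ha : 1 ≤ a) (s : ℂ) :
    IntegrableOn (fun y : ℝ => ((a:ℂ) + y * Complex.I) ^ (-s) * (afeK y : ℂ)) (Set.Ioi 0) ∧
    DifferentiableAt ℂ (fun s : ℂ => afeUp s a) s :=
  afe_param ha (fun y => (a:ℂ) + y * Complex.I) (by fun_prop) (by simp) (by simp) s

lemma afeDn_param {a : ℝ} (ha : 1 ≤ a) (s : ℂ) :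
    IntegrableOn (fun y : ℝ => ((a:ℂ) - y * Complex.I) ^ (-s) * (afeK y : ℂ)) (Set.Ioi 0) ∧
    DifferentiableAt ℂ (fun s : ℂ => afeDn s a) s :=
  afe_param ha (fun y => (a:ℂ) - y * Complex.I) (by fun_prop) (by simp) (by simp) s

def afeH (s : ℂ) (a : ℝ) : ℂ := afeF s a + Complex.I * (afeUp s a - afeDn s a)

lemma afeH_tendsto {a : ℝ} (ha : 1 ≤ a) (s : ℂ) :
    Filter.Tendsto (fun H : ℝ => afeF s a + Complex.I * ∫ y in (0:ℝ)..H, afeD s a y * (afeK y : ℂ)) Filter.atTop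
      (nhds (afeH s a)) := by
  have h1 := (afeUp_param ha s).1
  have h2 := (afeDn_param ha s).1
  have h3 : IntegrableOn (fun y : ℝ => afeD s a y * (afeK y : ℂ)) (Set.Ioi 0) := by
    refine (h1.sub h2).congr ?_
    refine Filter.Eventually.of_forall fun y => ?_
    simp only [afeD, Pi.sub_apply]; ring
  have h4 := intervalIntegral_tendsto_integral_Ioi 0 h3 Filter.tendsto_id
  have h5 : ∫ y in Set.Ioi (0:ℝ), afeD s a y * (afeK y : ℂ) = afeUp s a - afeDn s a := by
    unfold afeUp afeDn
    rw [← integral_sub h1 h2]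
    congr 1; ext y; simp only [afeD]; ring
  rw [h5] at h4
  exact (h4.const_mul _).const_add _

lemma afe_step {s : ℂ} (hs : s ≠ 1) (hσ : 0 ≤ s.re) (ht : 0 ≤ s.im) {n : ℕ} (hn : 2 ≤ n) :
    (n:ℂ) ^ (-s) = afeH s (n + 1/2) - afeH s (n - 1/2) := by
  have hn' : (2:ℝ) ≤ n := by exact_mod_cast hn
  have h1 := afeH_tendsto (a := n + 1/2) (by linarith) s
  have h2 := afeH_tendsto (a := n - 1/2) (by linarith) s
  have h3 := ((h1.sub h2).const_sub ((n:ℂ) ^ (-s))).norm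
  have h4 : Filter.Tendsto (fun H : ℝ => 4 * ((1/2) ^ (-s.re) * Real.exp (s.im * (π / 2))) / H) Filter.atTop (nhds 0) :=
    Filter.Tendsto.const_div_atTop Filter.tendsto_id _
  have h5 := le_of_tendsto_of_tendsto h3 h4 (by
    filter_upwards [Filter.eventually_gt_atTop 0] with H hH
    exact afe_step_fin hs hσ ht (by omega) hH)
  have h6 := norm_le_zero_iff.mp h5
  exact sub_eq_zero.mp h6

lemma afe_half_bound {s : ℂ} (hσ : 0 ≤ s.re) (ht : 0 ≤ s.im) {a : ℝ} (ha : 1 ≤ a) (w : ℝ → ℂ) (hre : ∀ y, (w y).re = a) :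
    ‖∫ y in Set.Ioi (0:ℝ), (w y) ^ (-s) * (afeK y : ℂ)‖ ≤
      a ^ (-s.re) * (Real.exp (s.im * (π / 2)) * ∫ y in Set.Ioi (0:ℝ), Real.exp (-1 * y)) := by
  have hbi := (exp_neg_integrableOn_Ioi 0 one_pos).const_mul (a ^ (-s.re) * Real.exp (s.im * (π / 2)))
  refine (norm_integral_le_of_norm_le hbi ?_).trans (le_of_eq ?_)
  · filter_upwards [ae_restrict_mem measurableSet_Ioi] with y hy
    rw [norm_mul, Complex.norm_real, Real.norm_of_nonneg (afeK_nonneg y)]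
    have hy' : (0:ℝ) ≤ y := le_of_lt hy
    have h1 := afe_f_bound hσ ht (by linarith) (hre y).ge
    have h2 : afeK y ≤ Real.exp (-1 * y) := by
      refine le_trans ?_ (afeK_exp_le hy')
      have := Real.one_le_exp hy'
      nlinarith [afeK_nonneg y]
    have := afeK_nonneg y
    gcongr
  · rw [integral_const_mul]; ring

lemma afeH_zero {s : ℂ} (hσ : 1 < s.re) (ht : 0 ≤ s.im) :
    Filter.Tendsto (fun N : ℕ => afeH s (N + 1/2)) Filter.atTop (nhds 0) := by
  set J := Real.exp (s.im * (π / 2)) * ∫ y in Set.Ioi (0:ℝ), Real.exp (-1 * y) with hJ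
  have hcast : Filter.Tendsto (fun N : ℕ => (N:ℝ) + 1/2) Filter.atTop Filter.atTop :=
    Filter.tendsto_atTop_add_const_right _ _ tendsto_natCast_atTop_atTop
  have h1 : Filter.Tendsto (fun N : ℕ => ((N:ℝ) + 1/2) ^ (-(s.re - 1)) / ‖1 - s‖ +
      (((N:ℝ) + 1/2) ^ (-s.re) * J + ((N:ℝ) + 1/2) ^ (-s.re) * J)) Filter.atTop (nhds 0) := by
    have e1 := (tendsto_rpow_neg_atTop (show 0 < s.re - 1 by linarith)).comp hcast
    have e2 := (tendsto_rpow_neg_atTop (show 0 < s.re by linarith)).comp hcast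
    have := (e1.div_const ‖1 - s‖).add ((e2.mul_const J).add (e2.mul_const J))
    simpa using this
  refine squeeze_zero_norm' ?_ h1
  filter_upwards [Filter.eventually_ge_atTop 1] with N hN
  have hN' : (1:ℝ) ≤ N := by exact_mod_cast hN
  unfold afeH
  refine (norm_add_le _ _).trans ?_
  refine add_le_add (le_of_eq ?_) ?_
  · rw [afeF, norm_div, Complex.norm_cpow_eq_rpow_re_of_pos (by linarith)]
    congr 2; simp
  · rw [norm_mul, Complex.norm_I, one_mul]
    refine (norm_sub_le _ _).trans (add_le_add ?_ ?_)
    · exact afe_half_bound (by linarith) ht (by linarith) (fun y => (((N:ℝ) + 1/2 : ℝ):ℂ) + y * Complex.I) (by simp)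
    · exact afe_half_bound (by linarith) ht (by linarith) (fun y => (((N:ℝ) + 1/2 : ℝ):ℂ) - y * Complex.I) (by simp)

lemma afe_sum_range (s : ℂ) (m : ℕ) :
    ∑ n ∈ Finset.Icc 1 m, (n:ℂ) ^ (-s) = ∑ i ∈ Finset.range m, 1 / ((i:ℂ) + 1) ^ s := by
  induction m with
  | zero => simp
  | succ n ih =>
    rw [Finset.sum_Icc_succ_top (by omega), Finset.sum_range_succ, ih, Complex.cpow_neg]
    push_cast; simp

lemma afe_zeta_gt {s : ℂ} (hσ : 1 < s.re) (ht : 0 ≤ s.im) {m : ℕ} (hm : 1 ≤ m) :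
    riemannZeta s - ∑ n ∈ Finset.Icc 1 m, (n:ℂ) ^ (-s) = - afeH s (m + 1/2) := by
  have hs : s ≠ 1 := by rintro rfl; simp at hσ
  have hsum : Filter.Tendsto (fun N : ℕ => ∑ n ∈ Finset.Icc 1 N, (n:ℂ) ^ (-s)) Filter.atTop (nhds (riemannZeta s)) := by
    simp_rw [afe_sum_range]
    rw [zeta_eq_tsum_one_div_nat_add_one_cpow hσ]
    apply HasSum.tendsto_sum_nat
    apply Summable.hasSum
    have := (summable_nat_add_iff 1).mpr (Complex.summable_one_div_nat_cpow.mpr hσ)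
    simpa using this
  have htel : ∀ N, m ≤ N → ∑ n ∈ Finset.Icc 1 N, (n:ℂ) ^ (-s) =
      ∑ n ∈ Finset.Icc 1 m, (n:ℂ) ^ (-s) + (afeH s (N + 1/2) - afeH s (m + 1/2)) := by
    intro N hN
    induction N, hN using Nat.le_induction with
    | base => simp
    | succ N hN ih =>
      rw [Finset.sum_Icc_succ_top (by omega), ih, afe_step hs (by linarith) ht (n := N + 1) (by omega)]
      have : ((N + 1 : ℕ) : ℝ) - 1/2 = N + 1/2 := by push_cast; ring
      rw [this]; ring
  have h2 : Filter.Tendsto (fun N : ℕ => ∑ n ∈ Finset.Icc 1 N, (n:ℂ) ^ (-s)) Filter.atTop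
      (nhds (∑ n ∈ Finset.Icc 1 m, (n:ℂ) ^ (-s) + (0 - afeH s (m + 1/2)))) := by
    refine Filter.Tendsto.congr' ?_ (((afeH_zero hσ ht).sub_const _).const_add _)
    filter_upwards [Filter.eventually_ge_atTop m] with N hN
    exact (htel N hN).symm
  rw [tendsto_nhds_unique hsum h2]; ring

lemma afe_zeta {s : ℂ} (ht : 0 < s.im) {m : ℕ} (hm : 1 ≤ m) :
    riemannZeta s - ∑ n ∈ Finset.Icc 1 m, (n:ℂ) ^ (-s) = - afeH s (m + 1/2) := by
  have hm' : (1:ℝ) ≤ m := by exact_mod_cast hm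
  set U : Set ℂ := {z | 0 < z.im} with hU
  have hUo : IsOpen U := isOpen_lt continuous_const Complex.continuous_im
  have hUc : IsPreconnected U := (convex_halfSpace_im_gt 0).isPreconnected
  have hne : ∀ z ∈ U, z ≠ 1 := by
    rintro z hz rfl; simp [hU] at hz
  have d1 : DifferentiableOn ℂ (fun s => riemannZeta s - ∑ n ∈ Finset.Icc 1 m, (n:ℂ) ^ (-s)) U := by
    intro z hz
    refine DifferentiableAt.differentiableWithinAt ?_
    refine (differentiableAt_riemannZeta (hne z hz)).sub ?_
    refine DifferentiableAt.fun_sum fun n hn => ?_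
    have : (n:ℂ) ≠ 0 := by
      have := (Finset.mem_Icc.mp hn).1
      exact_mod_cast (by omega : n ≠ 0)
    exact (differentiableAt_id.neg).const_cpow (Or.inl this)
  have d2 : DifferentiableOn ℂ (fun s => - afeH s (m + 1/2)) U := by
    intro z hz
    refine DifferentiableAt.differentiableWithinAt ?_
    unfold afeH
    refine DifferentiableAt.neg (DifferentiableAt.add ?_ (DifferentiableAt.const_mul
      ((afeUp_param (by linarith) z).2.sub (afeDn_param (by linarith) z).2) _))
    unfold afeF
    refine DifferentiableAt.div ?_ (differentiableAt_id.const_sub 1) (sub_ne_zero.mpr (hne z hz).symm)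
    refine (differentiableAt_id.const_sub 1).const_cpow (Or.inl ?_)
    exact_mod_cast (show (m:ℝ) + 1/2 ≠ 0 by positivity)
  have hz0 : (2 + Complex.I) ∈ U := by simp [hU]
  have heq := AnalyticOnNhd.eqOn_of_preconnected_of_eventuallyEq (d1.analyticOnNhd hUo) (d2.analyticOnNhd hUo) hUc hz0 ?_
  · exact heq ht
  · have h1 : {z : ℂ | 1 < z.re} ∈ nhds (2 + Complex.I) :=
      (isOpen_lt continuous_const Complex.continuous_re).mem_nhds (by simp)
    filter_upwards [h1, hUo.mem_nhds hz0] with z hz1 hz2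
    exact afe_zeta_gt hz1 (le_of_lt hz2) hm

lemma afe_vq_int {a : ℝ} (ha : 1 ≤ a) (s : ℂ) {k : ℕ} (hk : 1 ≤ k) :
    IntegrableOn (fun y : ℝ => ((a:ℂ) + y * Complex.I) ^ (-s) * ((-1) ^ k * (Real.exp (-(2 * π * k * y)) : ℂ))) (Set.Ioi 0) := by
  obtain ⟨C, hC0, hC⟩ := afe_growth (a := a) (M := |s.re|) (T := |s.im|) ha (by positivity)
  have hk' : (1:ℝ) ≤ k := by exact_mod_cast hk
  have hbi : Integrable (fun y : ℝ => C * Real.exp (-1 * y)) (volume.restrict (Set.Ioi 0)) :=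
    (exp_neg_integrableOn_Ioi 0 one_pos).const_mul C
  refine Integrable.mono' hbi ?_ ?_
  · refine Continuous.aestronglyMeasurable ((afe_v_cont s (by linarith)).mul ?_)
    exact continuous_const.mul (Complex.continuous_ofReal.comp (by fun_prop))
  · filter_upwards [ae_restrict_mem measurableSet_Ioi] with y hy
    have hy' : (0:ℝ) < y := hy
    have h1 := (hC s ((a:ℂ) + y * Complex.I) y le_rfl le_rfl (by simp) (by simp [abs_of_pos hy'])).1
    rw [norm_mul, norm_mul, norm_pow, norm_neg, norm_one, one_pow, one_mul, Complex.norm_real,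
      Real.norm_of_nonneg (Real.exp_pos _).le]
    calc _ ≤ C * Real.exp y * Real.exp (-(2 * π * k * y)) := by gcongr
      _ = C * (Real.exp (y + -(2 * π * k * y))) := by rw [Real.exp_add]; ring
      _ ≤ _ := by
        gcongr
        have : 1 * 3 * 1 * y ≤ 2 * π * k * y := by
          have := Real.pi_gt_three
          gcongr; norm_num
        linarith

lemma afe_vq_eq {a : ℝ} (ha : 1 ≤ a) (hE : Complex.exp (2 * π * Complex.I * a) = -1) {s : ℂ} (ht : 0 < s.im)
    {k : ℕ} (hk : 1 ≤ k) :
    Complex.I * ∫ y in Set.Ioi (0:ℝ), ((a:ℂ) + y * Complex.I) ^ (-s) * ((-1) ^ k * (Real.exp (-(2 * π * k * y)) : ℂ)) =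
      afeFull s (k:ℝ) - afePhi s (2 * π * Complex.I * ((k:ℝ):ℂ)) a := by
  have hk' : (1:ℝ) ≤ k := by exact_mod_cast hk
  have hint := afe_vq_int ha s hk
  set f : ℝ → ℂ := fun y => afePhi s (2 * π * Complex.I * ((k:ℝ):ℂ)) (a + Complex.I * y) with hf
  have hd : ∀ y ∈ Set.Ici (0:ℝ), HasDerivAt f (Complex.I *
      (((a:ℂ) + y * Complex.I) ^ (-s) * ((-1) ^ k * (Real.exp (-(2 * π * k * y)) : ℂ)))) y := by
    intro y _
    have h2 : HasDerivAt (fun y : ℝ => (a:ℂ) + Complex.I * y) (Complex.I * ((1:ℝ):ℂ)) y :=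
      ((hasDerivAt_id y).ofReal_comp.const_mul _).const_add _
    have h3 := (afePhi_hasDerivAt ht.ne' (2 * π * Complex.I * ((k:ℝ):ℂ)) (z := (a:ℂ) + Complex.I * y)
      (Or.inl (by simp; linarith))).comp y h2
    refine h3.congr_deriv ?_
    have e1 : Complex.exp (2 * π * Complex.I * ((k:ℝ):ℂ) * (a + Complex.I * y)) =
        (-1) ^ k * (Real.exp (-(2 * π * k * y)) : ℂ) := by
      have : 2 * π * Complex.I * ((k:ℝ):ℂ) * (a + Complex.I * y) = k * (2 * π * Complex.I * a) +
          ((-(2 * π * k * y) : ℝ) : ℂ) := by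
        push_cast; linear_combination (2 * π * k * y) * Complex.I_sq
      rw [this, Complex.exp_add, Complex.exp_nat_mul, hE, Complex.ofReal_exp]
    rw [e1, mul_comm (Complex.I) (y:ℂ)]
    push_cast; ring
  have hlim : Filter.Tendsto f Filter.atTop (nhds (afeFull s k)) :=
    afePhi_tendsto ht (by linarith) (a := a) (by linarith) (fun _ => a) (fun Y hY => by linarith) (fun Y hY => by linarith)
  have h := integral_Ioi_of_hasDerivAt_of_tendsto' hd (hint.const_mul Complex.I) hlim
  rw [integral_const_mul] at h
  rw [h]
  simp [hf]

lemma afeK_expand (N : ℕ) (y : ℝ) :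
    -(afeK y : ℂ) = (∑ k ∈ Finset.Icc 1 N, (-1) ^ k * (Real.exp (-(2 * π * k * y)) : ℂ)) +
      (-1) ^ (N + 1) * ((Real.exp (-(2 * π * N * y)) * afeK y : ℝ) : ℂ) := by
  set q := Real.exp (-(2 * π * y)) with hq
  have hq0 : 0 < q := Real.exp_pos _
  have h1 : ∀ k : ℕ, Real.exp (-(2 * π * k * y)) = q ^ k := by
    intro k; rw [hq, ← Real.exp_nat_mul]; congr 1; ring
  have h2 : afeK y = q / (1 + q) := by
    have : Real.exp (2 * π * y) = q⁻¹ := by rw [hq, Real.exp_neg, inv_inv]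
    rw [afeK, this]; field_simp; ring
  simp_rw [h1]
  rw [h2]
  have h3 : (1 + (q:ℂ)) ≠ 0 := by exact_mod_cast (by positivity : 1 + q ≠ 0)
  induction N with
  | zero => simp
  | succ n ih =>
    rw [Finset.sum_Icc_succ_top (by omega)]
    rw [ih]
    push_cast
    field_simp
    ring

lemma afeUp_expand {a : ℝ} (ha : 1 ≤ a) (hE : Complex.exp (2 * π * Complex.I * a) = -1) {s : ℂ} (ht : 0 < s.im) (N : ℕ) :
    -(Complex.I * afeUp s a) = (∑ k ∈ Finset.Icc 1 N, (afeFull s ((k:ℕ):ℝ) - afePhi s (2 * π * Complex.I * ((k:ℝ):ℂ)) a)) +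
      Complex.I * ((-1) ^ (N + 1) * ∫ y in Set.Ioi (0:ℝ), ((a:ℂ) + y * Complex.I) ^ (-s) *
        ((Real.exp (-(2 * π * N * y)) * afeK y : ℝ) : ℂ)) := by
  have h1 : ∀ k ∈ Finset.Icc 1 N, IntegrableOn (fun y : ℝ => ((a:ℂ) + y * Complex.I) ^ (-s) *
      ((-1) ^ k * (Real.exp (-(2 * π * k * y)) : ℂ))) (Set.Ioi 0) :=
    fun k hk => afe_vq_int ha s (Finset.mem_Icc.mp hk).1
  have e1 : ∑ k ∈ Finset.Icc 1 N, (afeFull s ((k:ℕ):ℝ) - afePhi s (2 * π * Complex.I * ((k:ℝ):ℂ)) a) =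
      Complex.I * ∫ y in Set.Ioi (0:ℝ), ∑ k ∈ Finset.Icc 1 N, ((a:ℂ) + y * Complex.I) ^ (-s) *
      ((-1) ^ k * (Real.exp (-(2 * π * k * y)) : ℂ)) := by
    rw [integral_finsetSum _ h1, Finset.mul_sum]
    exact Finset.sum_congr rfl fun k hk => (afe_vq_eq ha hE ht (Finset.mem_Icc.mp hk).1).symm
  have h2 : IntegrableOn (fun y : ℝ => ∑ k ∈ Finset.Icc 1 N, ((a:ℂ) + y * Complex.I) ^ (-s) *
      ((-1) ^ k * (Real.exp (-(2 * π * k * y)) : ℂ))) (Set.Ioi 0) := integrable_finsetSum _ h1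
  have h3 := (afeUp_param ha s).1
  rw [e1]
  have h4 : (∫ y in Set.Ioi (0:ℝ), (-1) ^ (N + 1) * (((a:ℂ) + y * Complex.I) ^ (-s) *
        ((Real.exp (-(2 * π * N * y)) * afeK y : ℝ) : ℂ))) = -(afeUp s a) - ∫ y in Set.Ioi (0:ℝ), ∑ k ∈ Finset.Icc 1 N, ((a:ℂ) + y * Complex.I) ^ (-s) *
      ((-1) ^ k * (Real.exp (-(2 * π * k * y)) : ℂ)) := by
    unfold afeUp
    have h5 : IntegrableOn (fun y : ℝ => -(((a:ℂ) + y * Complex.I) ^ (-s) * (afeK y : ℂ))) (Set.Ioi 0) := h3.neg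
    rw [← integral_neg, ← integral_sub h5 h2]
    congr 1; ext y
    have := afeK_expand N y
    rw [← Finset.mul_sum]
    linear_combination (-((a:ℂ) + y * Complex.I) ^ (-s)) * this
  rw [integral_const_mul] at h4
  linear_combination (-Complex.I) * h4

lemma afe_base_bound {s : ℂ} {M a y e : ℝ} (hM1 : 1 ≤ M) (hM : |s.re| ≤ M) (ha : 1 ≤ a) (hy : 0 ≤ y)
    {z : ℂ} (hz : z.re = a) (hzi : |z.im| = y) (he : s.im * z.arg ≤ e) :
    ‖z ^ (-s)‖ ≤ (4 * M + 1) ^ M * a ^ (-s.re) * Real.exp (y / 2 + e) := by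
  have hz0 : z ≠ 0 := by intro h; rw [h] at hz; simp at hz; linarith
  rw [afe_norm_cpow s hz0, Real.exp_add]
  have h1 : a ≤ ‖z‖ := by rw [← hz]; exact (le_abs_self _).trans (Complex.abs_re_le_norm z)
  have h2 : ‖z‖ ≤ a + y := by
    have := Complex.norm_le_abs_re_add_abs_im z
    rw [hz, hzi, abs_of_pos (by linarith)] at this; exact this
  have h3 : ‖z‖ / a ≤ 1 + 2 * y := by
    rw [div_le_iff₀ (by linarith)]; nlinarith
  have h4 := afe_rpow_le_up (σ := s.re) (by linarith : 0 < a) h1 h3 hM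
  have h5 := afe_poly_exp hy hM1
  have ha' : 0 < a ^ (-s.re) := Real.rpow_pos_of_pos (by linarith) _
  calc _ ≤ (a ^ (-s.re) * ((4 * M + 1) ^ M * Real.exp (y / 2))) * Real.exp e := by
        refine mul_le_mul ?_ (Real.exp_le_exp.mpr he) (Real.exp_pos _).le (by positivity)
        exact h4.trans (by gcongr)
    _ = _ := by ring

lemma afe_int_bound {g : ℝ → ℂ} {c : ℝ} (h : ∀ y, 0 < y → ‖g y‖ ≤ c * Real.exp (-y)) :
    ‖∫ y in Set.Ioi (0:ℝ), g y‖ ≤ c := by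
  have hi : Integrable (fun y : ℝ => c * Real.exp (-y)) (volume.restrict (Set.Ioi 0)) := by
    have := (exp_neg_integrableOn_Ioi 0 one_pos).const_mul c
    simpa using this
  have := norm_integral_le_of_norm_le hi (f := g) (by
    filter_upwards [ae_restrict_mem measurableSet_Ioi] with y hy using h y hy)
  rwa [integral_const_mul, integral_exp_neg_Ioi_zero, mul_one] at this

lemma afeDn_bound {s : ℂ} {M a : ℝ} (hM1 : 1 ≤ M) (hM : |s.re| ≤ M) (ha : 1 ≤ a) (ht : 0 < s.im) :
    ‖afeDn s a‖ ≤ (4 * M + 1) ^ M * a ^ (-s.re) := by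
  refine afe_int_bound fun y hy => ?_
  have h := afe_base_bound (s := s) (e := 0) hM1 hM ha hy.le (z := (a:ℂ) - y * Complex.I) (by simp)
    (by simp [abs_of_pos hy]) (by
      have : ((a:ℂ) - y * Complex.I).arg < 0 := Complex.arg_neg_iff.mpr (by simp [hy])
      nlinarith)
  rw [norm_mul, Complex.norm_real, Real.norm_of_nonneg (afeK_nonneg y)]
  have ha' : 0 < a ^ (-s.re) := Real.rpow_pos_of_pos (by linarith) _
  calc _ ≤ (4 * M + 1) ^ M * a ^ (-s.re) * Real.exp (y / 2 + 0) * Real.exp (-(2 * π * y)) := by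
        gcongr
        · exact afeK_nonneg y
        · exact afeK_le y
    _ = (4 * M + 1) ^ M * a ^ (-s.re) * Real.exp (y / 2 + 0 + -(2 * π * y)) := by rw [mul_assoc, ← Real.exp_add]
    _ ≤ _ := by
        refine mul_le_mul_of_nonneg_left (Real.exp_le_exp.mpr ?_) (by positivity)
        nlinarith [Real.pi_gt_three]

lemma afeR_bound {s : ℂ} {M a α β : ℝ} (hM1 : 1 ≤ M) (hM : |s.re| ≤ M) (ha : 3/2 ≤ a) (ht : 0 < s.im)
    (hα : α ≤ a + 1/2) (hβ : 1 ≤ β) (hβ2 : β ≤ α) (hts : s.im = 2 * π * α * β) {N : ℕ} (hN : β ≤ N) :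
    ‖∫ y in Set.Ioi (0:ℝ), ((a:ℂ) + y * Complex.I) ^ (-s) *
        ((Real.exp (-(2 * π * N * y)) * afeK y : ℝ) : ℂ)‖ ≤ (4 * M + 1) ^ M * a ^ (-s.re) := by
  refine afe_int_bound fun y hy => ?_
  have hpi := Real.pi_gt_three
  have hta : s.im / a ≤ 2 * π * (β + 2/3) := by
    rw [div_le_iff₀ (by linarith), hts]
    have : α * β ≤ (β + 2/3) * a := by nlinarith
    nlinarith
  have h := afe_base_bound (s := s) (a := a) (e := s.im / a * y) hM1 hM (by linarith) hy.le (z := (a:ℂ) + y * Complex.I) (by simp)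
    (by simp [abs_of_pos hy]) (by
      have : ((a:ℂ) + y * Complex.I).arg ≤ y / a := by
        simpa using afe_arg_le_div (z := (a:ℂ) + y * Complex.I) (by simp; linarith) (by simp; linarith)
      calc _ ≤ s.im * (y / a) := by gcongr
        _ = _ := by ring)
  rw [norm_mul, Complex.norm_real, Real.norm_of_nonneg (mul_nonneg (Real.exp_pos _).le (afeK_nonneg y))]
  have ha' : 0 < a ^ (-s.re) := Real.rpow_pos_of_pos (by linarith) _
  calc _ ≤ (4 * M + 1) ^ M * a ^ (-s.re) * Real.exp (y / 2 + s.im / a * y) *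
        (Real.exp (-(2 * π * N * y)) * Real.exp (-(2 * π * y))) := by
        gcongr
        · exact mul_nonneg (Real.exp_pos _).le (afeK_nonneg y)
        · exact afeK_le y
    _ = (4 * M + 1) ^ M * a ^ (-s.re) * Real.exp (y / 2 + s.im / a * y + (-(2 * π * N * y) + -(2 * π * y))) := by
        rw [mul_assoc, ← Real.exp_add, ← Real.exp_add]
    _ ≤ _ := by
        refine mul_le_mul_of_nonneg_left (Real.exp_le_exp.mpr ?_) (by positivity)
        have h1 : s.im / a * y ≤ 2 * π * (β + 2/3) * y := by gcongr
        have h2 : 2 * π * β * y ≤ 2 * π * N * y := by gcongr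
        have h3 : 3 * y ≤ π * y := by gcongr
        nlinarith

lemma afeF_bound {s : ℂ} {a : ℝ} (ha : 1 ≤ a) (ht : 1 ≤ s.im) :
    ‖afeF s a‖ ≤ a * a ^ (-s.re) / √s.im := by
  have h0 : (0:ℝ) < a := by linarith
  have h1 : √s.im ≤ ‖1 - s‖ := by
    have : |(1 - s).im| ≤ ‖1 - s‖ := Complex.abs_im_le_norm _
    simp only [Complex.sub_im, Complex.one_im, zero_sub, abs_neg] at this
    rw [abs_of_pos (by linarith)] at this
    refine le_trans ?_ this
    rw [Real.sqrt_le_left (by linarith)]; nlinarith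
  have h2 : 0 < √s.im := Real.sqrt_pos.mpr (by linarith)
  rw [afeF, norm_div, Complex.norm_cpow_eq_rpow_re_of_pos h0]
  have : a ^ ((1 - s).re) = a * a ^ (-s.re) := by
    rw [show (1 - s).re = 1 + -s.re by simp; ring, Real.rpow_add h0, Real.rpow_one]
  rw [this]
  have ha' : 0 < a ^ (-s.re) := Real.rpow_pos_of_pos (by linarith) _
  gcongr

lemma afeLow_sum {M : ℝ} (hM1 : 1 ≤ M) : ∃ C, 0 ≤ C ∧ ∀ s : ℂ, |s.re| ≤ M → 2 * π ≤ s.im → ∀ β : ℝ, 1 ≤ β → β ≤ s.im →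
    ‖∑ k ∈ Finset.Icc 1 ⌊β⌋₊, afeLow s ((k:ℕ):ℝ)‖ ≤ C * (s.im ^ ((1:ℝ)/2 - s.re) * β ^ (s.re - 1)) := by
  obtain ⟨C, hC0, hC⟩ := afe_full_one_bound hM1
  refine ⟨C * (4 * (M + 2) + 1) ^ (M + 2), by positivity, fun s hs ht β hβ hβt => ?_⟩
  have hpi := Real.pi_gt_three
  have ht0 : 0 < s.im := by linarith
  have hb := abs_le.mp hs
  have hk : ∀ k ∈ Finset.Icc 1 ⌊β⌋₊, ‖afeLow s ((k:ℕ):ℝ)‖ ≤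
      Real.exp (-(π * s.im)) * ((β ^ (s.re - 1) * s.im ^ (M + 1)) * (C * s.im ^ ((1:ℝ)/2 - s.re))) := by
    intro k hk
    have hk1 : (1:ℝ) ≤ k := by exact_mod_cast (Finset.mem_Icc.mp hk).1
    have hk2 : (k:ℝ) ≤ β := (Nat.le_floor_iff (by linarith)).mp (Finset.mem_Icc.mp hk).2
    rw [afeLow_norm, afeFull_norm (by linarith)]
    have h1 : (k:ℝ) ^ (s.re - 1) ≤ β ^ (s.re - 1) * s.im ^ (M + 1) := by
      have e : (k:ℝ) ^ (s.re - 1) = k ^ (M + s.re) * k ^ (-(M + 1)) := by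
        rw [← Real.rpow_add (by linarith)]; congr 1; ring
      have e' : β ^ (s.re - 1) * β ^ (M + 1) = β ^ (M + s.re) := by
        rw [← Real.rpow_add (by linarith)]; congr 1; ring
      have h2 : (k:ℝ) ^ (-(M + 1)) ≤ 1 := Real.rpow_le_one_of_one_le_of_nonpos hk1 (by linarith)
      have h3 : (k:ℝ) ^ (M + s.re) ≤ β ^ (M + s.re) := Real.rpow_le_rpow (by linarith) hk2 (by linarith)
      have h4 : β ^ (M + 1) ≤ s.im ^ (M + 1) := Real.rpow_le_rpow (by linarith) hβt (by linarith)
      have h5 : 0 < β ^ (s.re - 1) := Real.rpow_pos_of_pos (by linarith) _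
      have h6 : 0 < (k:ℝ) ^ (M + s.re) := Real.rpow_pos_of_pos (by linarith) _
      calc _ = (k:ℝ) ^ (M + s.re) * (k:ℝ) ^ (-(M + 1)) := e
        _ ≤ (k:ℝ) ^ (M + s.re) * 1 := by gcongr
        _ ≤ β ^ (M + s.re) := by rw [mul_one]; exact h3
        _ = _ := e'.symm
        _ ≤ _ := by gcongr
    have h7 := hC s hs ht
    have h8 : 0 ≤ β ^ (s.re - 1) := Real.rpow_nonneg (by linarith) _
    have h9 : 0 ≤ s.im ^ (M + 1) := Real.rpow_nonneg (by linarith) _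
    refine mul_le_mul_of_nonneg_left (mul_le_mul h1 h7 (norm_nonneg _) (by positivity)) (Real.exp_pos _).le
  refine (norm_sum_le_of_le _ hk).trans ?_
  rw [Finset.sum_const, Nat.card_Icc, nsmul_eq_mul]
  simp only [Nat.add_sub_cancel]
  have hK : ((⌊β⌋₊:ℕ):ℝ) ≤ s.im := (Nat.floor_le (by linarith)).trans hβt
  have hp := afe_poly_exp (w := s.im) (M := M + 2) ht0.le (by linarith)
  have hq : s.im ^ (M + 2) ≤ (1 + 2 * s.im) ^ (M + 2) := Real.rpow_le_rpow ht0.le (by linarith) (by linarith)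
  have e2 : s.im ^ (M + 2) = s.im * s.im ^ (M + 1) := by
    rw [show M + 2 = 1 + (M + 1) by ring, Real.rpow_add ht0, Real.rpow_one]
  have hexp : Real.exp (s.im / 2) * Real.exp (-(π * s.im)) ≤ 1 := by
    rw [← Real.exp_add]; apply Real.exp_le_one_iff.mpr; nlinarith
  have hfin : s.im * s.im ^ (M + 1) * Real.exp (-(π * s.im)) ≤ (4 * (M + 2) + 1) ^ (M + 2) := by
    rw [← e2]
    calc _ ≤ ((4 * (M + 2) + 1) ^ (M + 2) * Real.exp (s.im / 2)) * Real.exp (-(π * s.im)) := by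
          gcongr; exact hq.trans hp
      _ = (4 * (M + 2) + 1) ^ (M + 2) * (Real.exp (s.im / 2) * Real.exp (-(π * s.im))) := by ring
      _ ≤ (4 * (M + 2) + 1) ^ (M + 2) * 1 := by gcongr
      _ = _ := mul_one _
  have h8 : 0 ≤ β ^ (s.re - 1) := Real.rpow_nonneg (by linarith) _
  have h9 : 0 ≤ s.im ^ (M + 1) := Real.rpow_nonneg (by linarith) _
  have h10 : 0 ≤ s.im ^ ((1:ℝ)/2 - s.re) := Real.rpow_nonneg (by linarith) _
  calc _ ≤ s.im * (Real.exp (-(π * s.im)) * ((β ^ (s.re - 1) * s.im ^ (M + 1)) * (C * s.im ^ ((1:ℝ)/2 - s.re)))) := by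
        gcongr
    _ = (s.im * s.im ^ (M + 1) * Real.exp (-(π * s.im))) * (C * (s.im ^ ((1:ℝ)/2 - s.re) * β ^ (s.re - 1))) := by ring
    _ ≤ (4 * (M + 2) + 1) ^ (M + 2) * (C * (s.im ^ ((1:ℝ)/2 - s.re) * β ^ (s.re - 1))) := by gcongr
    _ = _ := by ring

lemma afe_conv1 {α a σ M : ℝ} (hα : 1 ≤ α) (h1 : α / 2 ≤ a) (h2 : a ≤ 2 * α) (hσ : |σ| ≤ M) :
    a ^ (-σ) ≤ 2 ^ M * α ^ (-σ) := by
  rw [mul_comm]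
  rcases le_total a α with h | h
  · exact afe_rpow_le_down (by linarith) h1 h hσ
  · exact afe_rpow_le_up (by linarith) h (by rw [div_le_iff₀ (by linarith)]; linarith) hσ

lemma afe_conv2 {α β a σ M t : ℝ} (hα : 1 ≤ α) (hβ : 1 ≤ β) (h1 : α / 2 ≤ a) (h2 : a ≤ 2 * α) (hσ : |σ| ≤ M)
    (ht : t = 2 * π * α * β) :
    a * a ^ (-σ) / √t ≤ (2 * 2 ^ M * (2 * π) ^ M) * (t ^ ((1:ℝ)/2 - σ) * β ^ (σ - 1)) := by
  have hpi := Real.pi_gt_three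
  have h0 : 0 < α * β := by nlinarith
  have ht0 : 0 < t := by rw [ht]; have := mul_pos (by linarith : 0 < 2 * π) h0; linarith
  have hc := afe_conv1 hα h1 h2 hσ
  have hαe : α = t * ((2 * π)⁻¹ * β⁻¹) := by rw [ht]; field_simp
  have e1 : α * α ^ (-σ) = t ^ (1 - σ) * ((2 * π) ^ (σ - 1) * β ^ (σ - 1)) := by
    have : α * α ^ (-σ) = α ^ (1 - σ) := by
      rw [sub_eq_add_neg, Real.rpow_add (by linarith), Real.rpow_one]
    rw [this]
    nth_rewrite 1 [hαe]
    rw [Real.mul_rpow ht0.le (by positivity), Real.mul_rpow (by positivity) (by positivity),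
      Real.inv_rpow (by positivity), Real.inv_rpow (by positivity), ← Real.rpow_neg (by positivity),
      ← Real.rpow_neg (by positivity)]
    simp only [neg_sub]
  have e2 : t ^ (1 - σ) / √t = t ^ ((1:ℝ)/2 - σ) := by
    rw [Real.sqrt_eq_rpow, ← Real.rpow_sub ht0]; congr 1; ring
  have e3 : (2 * π) ^ (σ - 1) ≤ (2 * π) ^ M :=
    Real.rpow_le_rpow_of_exponent_le (by linarith) (by linarith [(abs_le.mp hσ).2])
  have hα' : 0 < α ^ (-σ) := Real.rpow_pos_of_pos (by linarith) _
  have ha' : 0 < a ^ (-σ) := Real.rpow_pos_of_pos (by linarith) _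
  have hM : (0:ℝ) < 2 ^ M := by positivity
  have h3 : 0 < t ^ ((1:ℝ)/2 - σ) * β ^ (σ - 1) := by positivity
  calc a * a ^ (-σ) / √t ≤ (2 * α) * (2 ^ M * α ^ (-σ)) / √t := by gcongr
    _ = 2 * 2 ^ M * (α * α ^ (-σ)) / √t := by ring
    _ = 2 * 2 ^ M * ((t ^ (1 - σ) / √t) * ((2 * π) ^ (σ - 1) * β ^ (σ - 1))) := by rw [e1]; ring
    _ = 2 * 2 ^ M * (2 * π) ^ (σ - 1) * (t ^ ((1:ℝ)/2 - σ) * β ^ (σ - 1)) := by rw [e2]; ring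
    _ ≤ _ := by gcongr

lemma afe_identity {s : ℂ} (ht : 0 < s.im) {m : ℕ} (hm : 1 ≤ m) {a : ℝ} (ha : a = m + 1/2)
    (hE : Complex.exp (2 * π * Complex.I * a) = -1) (K : ℕ) :
    riemannZeta s - ∑ n ∈ Finset.Icc 1 m, (n:ℂ) ^ (-s) - chi s * ∑ k ∈ Finset.Icc 1 K, (k:ℂ) ^ (-(1 - s)) =
      -afeF s a + Complex.I * afeDn s a +
      Complex.I * ((-1) ^ (K + 1 + 1) * ∫ y in Set.Ioi (0:ℝ), ((a:ℂ) + y * Complex.I) ^ (-s) *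
        ((Real.exp (-(2 * π * (K + 1 : ℕ) * y)) * afeK y : ℝ) : ℂ)) +
      (afeFull s ((K + 1 : ℕ):ℝ) - afePhi s (2 * π * Complex.I * (((K + 1 : ℕ):ℝ):ℂ)) a) +
      ((∑ k ∈ Finset.Icc 1 K, afePhi s (2 * π * Complex.I * ((k:ℕ):ℝ)) (-Complex.I * a)) -
        ∑ k ∈ Finset.Icc 1 K, afePhi s (2 * π * Complex.I * ((k:ℕ):ℝ)) a) -
      (∑ k ∈ Finset.Icc 1 K, afePhi s (2 * π * Complex.I * ((k:ℕ):ℝ)) (-Complex.I * a)) -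
      ∑ k ∈ Finset.Icc 1 K, afeLow s ((k:ℕ):ℝ) := by
  have hm' : (1:ℝ) ≤ m := by exact_mod_cast hm
  have h1 := afe_zeta ht hm
  have h2 := afeUp_expand (a := a) (by linarith) hE ht (K + 1)
  rw [Finset.sum_Icc_succ_top (by omega), Finset.sum_sub_distrib] at h2
  have h3 : chi s * ∑ k ∈ Finset.Icc 1 K, (k:ℂ) ^ (-(1 - s)) =
      ∑ k ∈ Finset.Icc 1 K, afeFull s ((k:ℕ):ℝ) + ∑ k ∈ Finset.Icc 1 K, afeLow s ((k:ℕ):ℝ) := by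
    rw [Finset.mul_sum, ← Finset.sum_add_distrib]
    refine Finset.sum_congr rfl fun k hk => ?_
    have hk1 : (0:ℝ) < k := by exact_mod_cast (Finset.mem_Icc.mp hk).1
    rw [afe_chi ht.ne' hk1]; simp
  rw [h3, h1, ← ha]
  unfold afeH
  linear_combination h2

set_option maxHeartbeats 1000000 in
lemma afe_main {M : ℝ} (hM1 : 1 ≤ M) : ∃ C, 0 ≤ C ∧ ∀ s : ℂ, |s.re| ≤ M → 2 * π ≤ s.im → ∀ α β : ℝ,
    1 ≤ β → β ≤ α → s.im = 2 * π * α * β →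
    ‖riemannZeta s - zetaSum α s - chi s * zetaSum β (1 - s)‖ ≤
      C * (α ^ (-s.re) + s.im ^ ((1:ℝ)/2 - s.re) * β ^ (s.re - 1)) := by
  obtain ⟨CL, hCL0, hCL⟩ := afeLow_sum hM1
  set P : ℝ := (4 * M + 1) ^ M with hP
  have hP0 : 0 < P := by positivity
  set Q : ℝ := 1 + 8 * P * Real.exp 3 + 8 * 2 ^ M * Real.exp 5 + 15 with hQ
  have hQ0 : 0 < Q := by positivity
  set W : ℝ := 2 * 2 ^ M * (2 * π) ^ M with hW
  have hW0 : 0 < W := by positivity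
  refine ⟨2 * P * 2 ^ M + Q * W + CL, by positivity, fun s hs ht α β hβ hβα hts => ?_⟩
  have hpi := Real.pi_gt_three
  have hpi4 := Real.pi_lt_four
  have hα : 1 ≤ α := by linarith
  have ht0 : 0 < s.im := by linarith
  have hm : 1 ≤ ⌊α⌋₊ := (Nat.one_le_floor_iff α).mpr hα
  have hmα : (⌊α⌋₊:ℝ) ≤ α := Nat.floor_le (by linarith)
  have hmα' : α < ⌊α⌋₊ + 1 := Nat.lt_floor_add_one α
  have hm' : (1:ℝ) ≤ ⌊α⌋₊ := by exact_mod_cast hm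
  set m := ⌊α⌋₊ with hmdef
  obtain ⟨a, ha⟩ : ∃ a : ℝ, a = m + 1/2 := ⟨_, rfl⟩
  have hE : Complex.exp (2 * π * Complex.I * a) = -1 := by
    rw [ha]
    have : 2 * π * Complex.I * ((m + 1/2 : ℝ):ℂ) = π * Complex.I + m * (2 * π * Complex.I) := by push_cast; ring
    rw [this, Complex.exp_add, Complex.exp_pi_mul_I, Complex.exp_nat_mul_two_pi_mul_I]; simp
  have hKβ : (⌊β⌋₊:ℝ) ≤ β := Nat.floor_le (by linarith)
  have hKβ' : β < ⌊β⌋₊ + 1 := Nat.lt_floor_add_one β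
  have hKn : (0:ℝ) ≤ ⌊β⌋₊ := Nat.cast_nonneg _
  have hlow := hCL s hs ht β hβ (by rw [hts]; nlinarith [mul_nonneg (by linarith : 0 ≤ α) (by linarith : 0 ≤ β)])
  have hid := afe_identity (s := s) ht0 hm ha hE ⌊β⌋₊
  unfold zetaSum
  rw [hid]
  set K := ⌊β⌋₊ with hK
  have ha1 : 3/2 ≤ a := by linarith
  have hβt : 2 * π * β ^ 2 ≤ s.im := by
    rw [hts]
    have : β * β ≤ α * β := by nlinarith
    nlinarith
  have hsq : 2.4 * β ≤ √s.im := by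
    apply Real.le_sqrt_of_sq_le; nlinarith [sq_nonneg β]
  have hKa : 2 * π * K * a ≤ s.im + π * β := by
    rw [hts]
    have : (K:ℝ) * a ≤ β * (α + 1/2) := by gcongr; linarith
    nlinarith
  have hpi2 := Real.pi_lt_d2
  have hββ : 2 * π * β ≤ s.im := by nlinarith
  have bF := afeF_bound (s := s) (a := a) (by linarith) (by linarith)
  have bD := afeDn_bound (a := a) hM1 hs (by linarith) ht0
  have bR := afeR_bound (a := a) hM1 hs ha1 ht0 (by linarith : α ≤ a + 1/2) hβ hβα hts (N := K + 1)
    (by push_cast; linarith)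
  have bY := afe_ray_bound (a := a) (α := α) (β := β) (k := ((K + 1 : ℕ):ℝ)) ht0 hM1 hs (by linarith) (by linarith) hβ
    (by linarith) (by push_cast; linarith) hts
  have bS := afe_seg_bound (a := a) ht0 hs (by linarith) K
    (fun u hu _ => afe_geom a u hE (mul_nonneg (by linarith) hu) K) (by nlinarith)
  have bN := afePhi_negI_sum (s := s) (a := a) (by linarith) (by linarith) K (by nlinarith) (by nlinarith)
  have c1 := afe_conv1 (a := a) (σ := s.re) hα (by linarith) (by linarith) hs
  have c2 := afe_conv2 (a := a) (σ := s.re) hα hβ (by linarith) (by linarith) hs hts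
  set Y := a * a ^ (-s.re) / √s.im with hY
  set T2 := s.im ^ ((1:ℝ)/2 - s.re) * β ^ (s.re - 1) with hT2
  have hT20 : 0 ≤ T2 := by positivity
  have hα0 : 0 ≤ α ^ (-s.re) := by positivity
  have nI : ∀ (n : ℕ) (z : ℂ), ‖Complex.I * ((-1) ^ n * z)‖ = ‖z‖ := by intro n z; simp
  have nI' : ∀ (z : ℂ), ‖Complex.I * z‖ = ‖z‖ := by intro z; simp
  have tri : ∀ z1 z2 z3 z4 z5 z6 z7 : ℂ, ‖-z1 + z2 + z3 + z4 + z5 - z6 - z7‖ ≤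
      ‖z1‖ + ‖z2‖ + ‖z3‖ + ‖z4‖ + ‖z5‖ + ‖z6‖ + ‖z7‖ := by
    intro z1 z2 z3 z4 z5 z6 z7
    have a1 := norm_sub_le (-z1 + z2 + z3 + z4 + z5 - z6) z7
    have a2 := norm_sub_le (-z1 + z2 + z3 + z4 + z5) z6
    have a3 := norm_add_le (-z1 + z2 + z3 + z4) z5
    have a4 := norm_add_le (-z1 + z2 + z3) z4
    have a5 := norm_add_le (-z1 + z2) z3
    have a6 := norm_add_le (-z1) z2
    rw [norm_neg] at a6
    linarith
  refine (tri _ _ _ _ _ _ _).trans ?_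
  rw [nI, nI']
  have hsum : 2 * (P * a ^ (-s.re)) + Q * Y + CL * T2 ≤ (2 * P * 2 ^ M + Q * W + CL) * (α ^ (-s.re) + T2) := by
    have d1 : P * a ^ (-s.re) ≤ P * (2 ^ M * α ^ (-s.re)) := by gcongr
    have d2 : Q * Y ≤ Q * (W * T2) := by gcongr
    have d3 : 0 ≤ 2 * P * 2 ^ M * T2 := by positivity
    have d4 : 0 ≤ (Q * W + CL) * α ^ (-s.re) := by positivity
    linarith
  refine le_trans ?_ hsum
  rw [hQ]
  linarith

lemma afe_Gammaℝ_conj (s : ℂ) : Complex.Gammaℝ ((starRingEnd ℂ) s) = (starRingEnd ℂ) (Complex.Gammaℝ s) := by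
  have hp : ((π:ℂ)).arg ≠ π := by
    rw [Complex.arg_ofReal_of_nonneg Real.pi_pos.le]; exact Real.pi_pos.ne
  rw [Complex.Gammaℝ_def, Complex.Gammaℝ_def, map_mul, ← Complex.Gamma_conj]
  have h1 : -(starRingEnd ℂ) s / 2 = (starRingEnd ℂ) (-s / 2) := by rw [map_div₀, map_neg, map_ofNat]
  have h2 : (starRingEnd ℂ) s / 2 = (starRingEnd ℂ) (s / 2) := by rw [map_div₀, map_ofNat]
  rw [h1, h2, Complex.cpow_conj _ _ hp, Complex.conj_ofReal]

lemma afe_chi_conj (s : ℂ) : chi ((starRingEnd ℂ) s) = (starRingEnd ℂ) (chi s) := by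
  rw [afe_chi_Gammaℝ, afe_chi_Gammaℝ, map_div₀, ← afe_Gammaℝ_conj, ← afe_Gammaℝ_conj]; simp

lemma afe_zetaSum_conj (x : ℝ) (s : ℂ) : zetaSum x ((starRingEnd ℂ) s) = (starRingEnd ℂ) (zetaSum x s) := by
  unfold zetaSum
  rw [map_sum]
  refine Finset.sum_congr rfl fun n _ => ?_
  have hp : ((n:ℂ)).arg ≠ π := by
    rw [Complex.natCast_arg]; exact Real.pi_pos.ne
  rw [← map_neg, Complex.cpow_conj _ _ hp, Complex.conj_natCast]

lemma afe_reflect {s : ℂ} (ht : 0 < s.im) (α β : ℝ) :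
    ‖riemannZeta s - zetaSum α s - chi s * zetaSum β (1 - s)‖ =
    ‖chi s‖ * ‖riemannZeta (1 - (starRingEnd ℂ) s) - zetaSum β (1 - (starRingEnd ℂ) s) -
      chi (1 - (starRingEnd ℂ) s) * zetaSum α (1 - (1 - (starRingEnd ℂ) s))‖ := by
  have g1 : Complex.Gammaℝ s ≠ 0 := by
    rw [Ne, Complex.Gammaℝ_eq_zero_iff]
    rintro ⟨n, h⟩
    have := congrArg Complex.im h
    simp at this; linarith
  have g2 : Complex.Gammaℝ (1 - s) ≠ 0 := by
    rw [Ne, Complex.Gammaℝ_eq_zero_iff]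
    rintro ⟨n, h⟩
    have := congrArg Complex.im h
    simp at this; linarith
  have z1 : s ≠ 0 := by rintro rfl; simp at ht
  have z2 : 1 - s ≠ 0 := by
    intro h
    have := congrArg Complex.im h
    simp at this; linarith
  have e : 1 - (starRingEnd ℂ) s = (starRingEnd ℂ) (1 - s) := by simp
  have e' : 1 - (starRingEnd ℂ) (1 - s) = (starRingEnd ℂ) s := by simp
  rw [e, e', riemannZeta_conj, afe_zetaSum_conj, afe_zetaSum_conj, afe_chi_conj, ← map_mul, ← map_sub, ← map_sub,
    Complex.norm_conj, ← norm_mul]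
  congr 1
  rw [riemannZeta_def_of_ne_zero z1, riemannZeta_def_of_ne_zero z2, completedRiemannZeta_one_sub,
    afe_chi_Gammaℝ, afe_chi_Gammaℝ, sub_sub_cancel]
  field_simp
  ring

theorem statement0 (A B : ℝ) :
    ∃ C : ℝ, ∀ s : ℂ, s.re ∈ Set.Icc A B → 2 * π ≤ s.im →
      ∀ α β : ℝ, 1 ≤ α → 1 ≤ β → s.im = 2 * π * α * β →
        ‖riemannZeta s - zetaSum α s - chi s * zetaSum β (1 - s)‖ ≤
          C * (α ^ (-s.re) + s.im ^ ((1:ℝ)/2 - s.re) * β ^ (s.re - 1)) := by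
  have hM1 : 1 ≤ max |A| |B| + 1 := by linarith [(abs_nonneg A).trans (le_max_left |A| |B|)]
  set M := max |A| |B| + 1 with hM
  obtain ⟨C, hC0, hC⟩ := afe_main hM1
  obtain ⟨D, hD0, hD⟩ := afe_full_one_bound hM1
  refine ⟨C + 2 * D * C, fun s hs ht α β hα hβ hts => ?_⟩
  have hpi := Real.pi_gt_three
  have ht0 : 0 < s.im := by linarith
  have hA : |A| ≤ M - 1 := by rw [hM]; linarith [le_max_left |A| |B|]
  have hB : |B| ≤ M - 1 := by rw [hM]; linarith [le_max_right |A| |B|]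
  have hA' := abs_le.mp hA
  have hB' := abs_le.mp hB
  have h1 : |s.re| ≤ M := abs_le.mpr ⟨by linarith [hs.1], by linarith [hs.2]⟩
  have hT : 0 ≤ α ^ (-s.re) + s.im ^ ((1:ℝ)/2 - s.re) * β ^ (s.re - 1) := by positivity
  rcases le_total β α with h | h
  · refine (hC s h1 ht α β hβ h hts).trans ?_
    gcongr
    have : 0 ≤ 2 * D * C := by positivity
    linarith
  · rw [afe_reflect ht0]
    have hb := hC (1 - (starRingEnd ℂ) s) (by
      rw [abs_le]; simp only [Complex.sub_re, Complex.one_re, Complex.conj_re]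
      exact ⟨by linarith [hs.2], by linarith [hs.1]⟩) (by simpa using ht) β α hα h (by simp [hts]; ring)
    have e1 : (1 - (starRingEnd ℂ) s).re = 1 - s.re := by simp
    have e2 : (1 - (starRingEnd ℂ) s).im = s.im := by simp
    rw [e1, e2, show -(1 - s.re) = s.re - 1 by ring, show 1 - s.re - 1 = -s.re by ring,
      show (1:ℝ)/2 - (1 - s.re) = -((1:ℝ)/2 - s.re) by ring] at hb
    have hx : ‖chi s‖ ≤ 2 * (D * s.im ^ ((1:ℝ)/2 - s.re)) :=
      (afe_chi_norm ht0).trans (by linarith [hD s h1 ht])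
    have hc : s.im ^ ((1:ℝ)/2 - s.re) * s.im ^ (-((1:ℝ)/2 - s.re)) = 1 := by
      rw [← Real.rpow_add ht0, add_neg_cancel, Real.rpow_zero]
    calc _ ≤ 2 * (D * s.im ^ ((1:ℝ)/2 - s.re)) * (C * (β ^ (s.re - 1) + s.im ^ (-((1:ℝ)/2 - s.re)) * α ^ (-s.re))) :=
          mul_le_mul hx hb (norm_nonneg _) (by positivity)
      _ = 2 * D * C * ((s.im ^ ((1:ℝ)/2 - s.re) * s.im ^ (-((1:ℝ)/2 - s.re))) * α ^ (-s.re) +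
          s.im ^ ((1:ℝ)/2 - s.re) * β ^ (s.re - 1)) := by ring
      _ = 2 * D * C * (α ^ (-s.re) + s.im ^ ((1:ℝ)/2 - s.re) * β ^ (s.re - 1)) := by rw [hc, one_mul]
      _ ≤ _ := by gcongr; linarith

end
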